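/- arXiv:2110.03650 — 3 statements merged into one kernel-verified Lean document; each statement's English description precedes it below -/
import Mathlib

section
/- Let S be a commutative ring in which 2 = 0. For x ∈ S with x^8 = 0, let M(x) denote the 3×3 upper unitriangular matrix over S with entries M(x)_{1,2} = x^2, M(x)_{1,3} = x, M(x)_{2,3} = x^4 (and 1's on the diagonal, 0 below). Then: (i) for all x, y ∈ S with x^8 = 0 and y^8 = 0, the element z := x + y + x^2·y^4 satisfies z^8 = 0 and M(x)·M(y) = M(z); (ii) M(0) is the identity matrix; (iii) for every x with x^8 = 0 one has (x + x^6)^8 = 0 and M(x)·M(x + x^6) is the identity matrix. Consequently, the set {M(x) : x ∈ S, x^8 = 0} is a subgroup of GL_3(S). -/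
open Matrix

/-- The upper unitriangular matrix `M(x)` with entries `M(x)₀₁ = x²`, `M(x)₀₂ = x`,
`M(x)₁₂ = x⁴`, ones on the diagonal and zeros below. -/
def Mmat {S : Type} [CommRing S] (x : S) : Matrix (Fin 3) (Fin 3) S :=
  !![1, x ^ 2, x; 0, 1, x ^ 4; 0, 0, 1]

theorem add_sq_of_two_eq_zero {S : Type*} [CommRing S] (h2 : (2 : S) = 0) (a b : S) :
    (a + b) ^ 2 = a ^ 2 + b ^ 2 := by
  linear_combination a * b * h2

theorem add_pow_four_of_two_eq_zero {S : Type*} [CommRing S] (h2 : (2 : S) = 0) (a b : S) :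
    (a + b) ^ 4 = a ^ 4 + b ^ 4 := by
  linear_combination (2 * a ^ 3 * b + 3 * a ^ 2 * b ^ 2 + 2 * a * b ^ 3) * h2

theorem add_pow_eight_of_two_eq_zero {S : Type*} [CommRing S] (h2 : (2 : S) = 0) (a b : S) :
    (a + b) ^ 8 = a ^ 8 + b ^ 8 := by
  have h (c : S) : c ^ 8 = (c ^ 4) ^ 2 := by ring
  rw [h, add_pow_four_of_two_eq_zero h2, add_sq_of_two_eq_zero h2, ← h, ← h]

theorem Mmat_zero {S : Type} [CommRing S] : Mmat (0 : S) = 1 := by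
  ext i j
  fin_cases i <;> fin_cases j <;> simp [Mmat]

theorem Mmat_mul {S : Type} [CommRing S] (h2 : (2 : S) = 0) {y : S} (x : S) (hy : y ^ 8 = 0) :
    Mmat x * Mmat y = Mmat (x + y + x ^ 2 * y ^ 4) := by
  have hsq : (x + y + x ^ 2 * y ^ 4) ^ 2 = y ^ 2 + x ^ 2 := by
    rw [add_sq_of_two_eq_zero h2, add_sq_of_two_eq_zero h2]
    linear_combination x ^ 4 * hy
  have hfour : (x + y + x ^ 2 * y ^ 4) ^ 4 = y ^ 4 + x ^ 4 := by
    rw [add_pow_four_of_two_eq_zero h2, add_pow_four_of_two_eq_zero h2]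
    linear_combination x ^ 8 * y ^ 8 * hy
  have hcorner : y + x ^ 2 * y ^ 4 + x = x + y + x ^ 2 * y ^ 4 := by ring
  ext i j
  fin_cases i <;> fin_cases j <;>
    simp [Mmat, Matrix.mul_apply, Fin.sum_univ_three, hsq, hfour, hcorner]

theorem mul_law_pow_eight {S : Type*} [CommRing S] (h2 : (2 : S) = 0) {x y : S}
    (hx : x ^ 8 = 0) (hy : y ^ 8 = 0) : (x + y + x ^ 2 * y ^ 4) ^ 8 = 0 := by
  rw [add_pow_eight_of_two_eq_zero h2, add_pow_eight_of_two_eq_zero h2]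
  linear_combination (1 + x ^ 8 * y ^ 32) * hx + hy

theorem inv_law_pow_eight {S : Type*} [CommRing S] (h2 : (2 : S) = 0) {x : S}
    (hx : x ^ 8 = 0) : (x + x ^ 6) ^ 8 = 0 := by
  rw [add_pow_eight_of_two_eq_zero h2]
  linear_combination (1 + x ^ 40) * hx

theorem Mmat_mul_inv {S : Type} [CommRing S] (h2 : (2 : S) = 0) {x : S} (hx : x ^ 8 = 0) :
    Mmat x * Mmat (x + x ^ 6) = 1 := by
  rw [Mmat_mul h2 x (inv_law_pow_eight h2 hx), ← Mmat_zero]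
  congr 1
  rw [add_pow_four_of_two_eq_zero h2]
  linear_combination (x + x ^ 6) * h2 + x ^ 18 * hx

/-- Over a commutative ring `S` with `2 = 0`, the matrices `M(x)` for
`x ∈ S` with `x⁸ = 0` are closed under multiplication (with `M(x)·M(y) = M(x+y+x²y⁴)`),
contain the identity `M(0) = 1`, and are closed under inverses (`M(x)⁻¹ = M(x+x⁶)`);
consequently `{M(x) : x⁸ = 0}` is a subgroup of `GL₃(S)`. -/
theorem Mmat_subgroup (S : Type) [CommRing S] (h2 : (2 : S) = 0) :
    -- (i) multiplication law
    (∀ x y : S, x ^ 8 = 0 → y ^ 8 = 0 →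
      (x + y + x ^ 2 * y ^ 4) ^ 8 = 0 ∧
      Mmat x * Mmat y = Mmat (x + y + x ^ 2 * y ^ 4)) ∧
    -- (ii) identity
    Mmat (0 : S) = 1 ∧
    -- (iii) inverses
    (∀ x : S, x ^ 8 = 0 →
      (x + x ^ 6) ^ 8 = 0 ∧ Mmat x * Mmat (x + x ^ 6) = 1) ∧
    -- consequently, {M(x) : x ∈ S, x⁸ = 0} is a subgroup of GL₃(S)
    (∃ H : Subgroup (GL (Fin 3) S), ∀ g : GL (Fin 3) S,
      g ∈ H ↔ ∃ x : S, x ^ 8 = 0 ∧ (g : Matrix (Fin 3) (Fin 3) S) = Mmat x) := by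
  refine ⟨fun x y hx hy => ⟨mul_law_pow_eight h2 hx hy, Mmat_mul h2 x hy⟩, Mmat_zero,
    fun x hx => ⟨inv_law_pow_eight h2 hx, Mmat_mul_inv h2 hx⟩, ?_⟩
  refine ⟨{ carrier := {g | ∃ x : S, x ^ 8 = 0 ∧ (g : Matrix (Fin 3) (Fin 3) S) = Mmat x}
            mul_mem' := ?_, one_mem' := ?_, inv_mem' := ?_ }, fun g => Iff.rfl⟩
  · rintro g h ⟨x, hx, hg⟩ ⟨y, hy, hh⟩
    exact ⟨_, mul_law_pow_eight h2 hx hy, by rw [Units.val_mul, hg, hh, Mmat_mul h2 x hy]⟩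
  · exact ⟨0, by simp, by rw [Units.val_one, Mmat_zero]⟩
  · rintro g ⟨x, hx, hg⟩
    exact ⟨_, inv_law_pow_eight h2 hx,
      Units.inv_eq_of_mul_eq_one_right (by rw [hg, Mmat_mul_inv h2 hx])⟩
end

section
/- Let k be an algebraically closed field of characteristic p = 5 and let R = k⟦x,y,z⟧/(z^2 + x^3 + y^5) (the rational double point of type E_8^0 in characteristic 5). With L and A as in the context: (i) the image of z/(xy) in L does not lie in A; (ii) (z/(xy))^5 lies in A; (iii) for every c ∈ L such that c^{5^m} ∈ A for some m ≥ 0, there exists a ∈ k such that c − a·(z/(xy)) ∈ A. In other words, the Frobenius-nilpotent part H^2_m(R)[F^∞] of local cohomology is the one-dimensional k-vector space spanned by the class of z/(xy), and it is annihilated by Frobenius. -/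
set_option maxHeartbeats 1000000
set_option synthInstance.maxHeartbeats 400000

open MvPowerSeries

noncomputable section

variable (k : Type) [Field k]

/-- The formal power series ring `k⟦x,y,z⟧`. -/
abbrev PS := MvPowerSeries (Fin 3) k

/-- The hypersurface singularity `R = k⟦x,y,z⟧/(f)`. -/
abbrev Rq (f : PS k) : Type := PS k ⧸ Ideal.span {f}

/-- The image of `x` in `R`. -/
abbrev xR (f : PS k) : Rq k f := Ideal.Quotient.mk _ (X 0)
/-- The image of `y` in `R`. -/
abbrev yR (f : PS k) : Rq k f := Ideal.Quotient.mk _ (X 1)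
/-- The image of `z` in `R`. -/
abbrev zR (f : PS k) : Rq k f := Ideal.Quotient.mk _ (X 2)

/-- `L`: the localization of `R` inverting `x*y`. -/
abbrev Lloc (f : PS k) : Type := Localization.Away (xR k f * yR k f)

/-- The canonical map from the localization of `R` inverting `x` to `L`. -/
noncomputable def phiX (f : PS k) : Localization.Away (xR k f) →+* Lloc k f :=
  IsLocalization.Away.awayToAwayRight (S := Localization.Away (xR k f)) (P := Lloc k f)
    (xR k f) (yR k f)

/-- The canonical map from the localization of `R` inverting `y` to `L`. -/
noncomputable def phiY (f : PS k) : Localization.Away (yR k f) →+* Lloc k f :=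
  IsLocalization.Away.awayToAwayLeft (S := Localization.Away (yR k f)) (P := Lloc k f)
    (yR k f) (xR k f)

/-- `A ⊆ L`: the `R`-submodule generated by the images of `R_x` and `R_y` in `L`.
The quotient `L/A` is a Čech description of the local cohomology `H^2_m(R)`. -/
def Asub (f : PS k) : Submodule (Rq k f) (Lloc k f) :=
  Submodule.span (Rq k f) (Set.range (phiX k f) ∪ Set.range (phiY k f))

/-- The element `z/(x*y) ∈ L`. -/
noncomputable def zxy (f : PS k) : Lloc k f :=
  Localization.mk (zR k f) ⟨xR k f * yR k f, Submonoid.mem_powers _⟩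

/-- The element `f_j := z/(x*y^j) = z*x^(j-1)/(x*y)^j ∈ L` (for `j ≥ 1`). -/
noncomputable def fcls (f : PS k) (j : ℕ) : Lloc k f :=
  Localization.mk (zR k f * xR k f ^ (j - 1)) ⟨(xR k f * yR k f) ^ j, j, rfl⟩

/-- The defining equation of the rational double point of type E8p0 in characteristic 5. -/
abbrev fRDP : PS k := X 2 ^ 2 + X 0 ^ 3 + X 1 ^ 5

/-- The coefficient of `x ^ a * y ^ b * z ^ e` (for `e ≤ 1`) in the normal form of the monomial
`x ^ A * y ^ B * z ^ C` with respect to the rewriting rule `z ^ 2 = -x ^ 3 - y ^ 5`. -/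
def monomialCoeff (e a b : ℕ) : ℕ → ℕ → ℕ → k
  | 0, A, B => if e = 0 ∧ A = a ∧ B = b then 1 else 0
  | 1, A, B => if e = 1 ∧ A = a ∧ B = b then 1 else 0
  | C + 2, A, B => -monomialCoeff e a b C (A + 3) B - monomialCoeff e a b C A (B + 5)

lemma monomialCoeff_support (e a b C A B : ℕ) (h : monomialCoeff k e a b C A B ≠ 0) :
    A ≤ a ∧ B ≤ b ∧ 10 * A + 6 * B + 15 * C = 10 * a + 6 * b + 15 * e := by
  induction C using Nat.twoStepInduction generalizing A B with
  | zero =>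
    simp only [monomialCoeff, ne_eq, ite_eq_right_iff, Classical.not_imp] at h
    omega
  | one =>
    simp only [monomialCoeff, ne_eq, ite_eq_right_iff, Classical.not_imp] at h
    omega
  | more C ih _ =>
    by_cases h₁ : monomialCoeff k e a b C (A + 3) B = 0
    · by_cases h₂ : monomialCoeff k e a b C A (B + 5) = 0
      · simp [monomialCoeff, h₁, h₂] at h
      · have := ih _ _ h₂
        omega
    · have := ih _ _ h₁
      omega

/-- The weight function on exponents given by `monomialCoeff`. -/
def weight (e a b : ℕ) (m : Fin 3 →₀ ℕ) : k := monomialCoeff k e a b (m 2) (m 0) (m 1)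

lemma weight_support_finite (e a b : ℕ) : (Function.support (weight k e a b)).Finite := by
  refine (Finset.finite_toSet (Finset.Iic (Finsupp.equivFunOnFinite.symm
    ![a, b, 10 * a + 6 * b + 15 * e]))).subset fun m hm => ?_
  have := monomialCoeff_support k e a b _ _ _ hm
  simp only [Finset.coe_Iic, Set.mem_Iic]
  intro i
  fin_cases i
  · exact this.1
  · exact this.2.1
  · change m 2 ≤ 10 * a + 6 * b + 15 * e
    omega

variable {k}

/-- The pairing of a finitely supported weight function with a power series. -/
def pairing (w : (Fin 3 →₀ ℕ) → k) (hw : (Function.support w).Finite) : PS k →ₗ[k] k where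
  toFun h := ∑ᶠ m, w m * coeff m h
  map_add' g h := by
    rw [← finsum_add_distrib]
    · simp only [map_add, mul_add]
    · exact hw.subset (Function.support_mul_subset_left _ _)
    · exact hw.subset (Function.support_mul_subset_left _ _)
  map_smul' c h := by
    simp only [map_smul, smul_eq_mul, RingHom.id_apply]
    rw [mul_finsum]
    exact finsum_congr fun m => by ring

lemma pairing_monomial_mul (w : (Fin 3 →₀ ℕ) → k) (hw : (Function.support w).Finite)
    (d : Fin 3 →₀ ℕ) (h : PS k) :
    pairing w hw (monomial d 1 * h) = ∑ᶠ m, w (d + m) * coeff m h := by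
  have hr := finsum_mem_range (f := fun m => w m * coeff m (monomial d (1 : k) * h))
    (add_right_injective d)
  simp only [coeff_add_monomial_mul, one_mul] at hr
  rw [← hr]
  change ∑ᶠ m, w m * coeff m (monomial d (1 : k) * h) = _
  rw [← finsum_mem_univ]
  refine finsum_mem_inter_support_eq' _ _ _ fun m hm => ?_
  simp only [Set.mem_univ, Set.mem_range, true_iff]
  have : coeff m (monomial d (1 : k) * h) ≠ 0 := right_ne_zero_of_mul hm
  rw [coeff_monomial_mul] at this
  have hdm : d ≤ m := by
    by_contra hdm
    simp [hdm] at this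
  exact ⟨m - d, add_tsub_cancel_of_le hdm⟩

lemma pairing_monomial (w : (Fin 3 →₀ ℕ) → k) (hw : (Function.support w).Finite)
    (d : Fin 3 →₀ ℕ) : pairing w hw (monomial d 1) = w d := by
  change ∑ᶠ m, w m * coeff m (monomial d (1 : k)) = w d
  rw [finsum_eq_single _ d]
  · simp
  · intro m hm
    simp [coeff_monomial_ne hm]

lemma pairing_fRDP_mul (e a b : ℕ) (h : PS k) :
    pairing _ (weight_support_finite k e a b) (fRDP k * h) = 0 := by
  have hfin (d : Fin 3 →₀ ℕ) :
      (Function.support fun m => weight k e a b (d + m) * coeff m h).Finite := by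
    refine Set.Finite.subset ((weight_support_finite k e a b).preimage
      (add_right_injective d).injOn) fun m hm => ?_
    exact left_ne_zero_of_mul hm
  rw [fRDP, add_mul, add_mul, map_add, map_add, X_pow_eq, X_pow_eq, X_pow_eq,
    pairing_monomial_mul, pairing_monomial_mul, pairing_monomial_mul,
    ← finsum_add_distrib (hfin _) (hfin _), ← finsum_add_distrib _ (hfin _)]
  · refine finsum_eq_zero_of_forall_eq_zero fun m => ?_
    simp only [weight, Finsupp.add_apply, Finsupp.single_apply]
    simp [add_comm _ (m _), monomialCoeff]
    ring
  · exact ((hfin _).union (hfin _)).subset (Function.support_add _ _)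

variable (k) in
/-- The coefficient of `x ^ a * y ^ b * z ^ e` in the normal form of an element of `R`. -/
def normalCoeff (e a b : ℕ) : Rq k (fRDP k) →ₗ[k] k :=
  Submodule.liftQ ((Ideal.span {fRDP k}).restrictScalars k)
    (pairing _ (weight_support_finite k e a b)) (by
      intro g hg
      obtain ⟨h, rfl⟩ := Ideal.mem_span_singleton'.1 hg
      rw [LinearMap.mem_ker, mul_comm]
      exact pairing_fRDP_mul e a b h) ∘ₗ
  (Submodule.Quotient.restrictScalarsEquiv k (Ideal.span {fRDP k})).symm.toLinearMap

lemma normalCoeff_mk (e a b : ℕ) (h : PS k) :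
    normalCoeff k e a b (Ideal.Quotient.mk _ h) =
      pairing _ (weight_support_finite k e a b) h := rfl

lemma normalCoeff_monomial (e a b A B C : ℕ) :
    normalCoeff k e a b (xR k _ ^ A * yR k _ ^ B * zR k _ ^ C) = monomialCoeff k e a b C A B := by
  rw [← map_pow, ← map_pow, ← map_pow, ← map_mul, ← map_mul, normalCoeff_mk, X_pow_eq, X_pow_eq,
    X_pow_eq, monomial_mul_monomial, monomial_mul_monomial, one_mul, one_mul, pairing_monomial]
  simp [weight]

lemma normalCoeff_xR_pow_mul (e a b n : ℕ) (hn : a < n) (r : Rq k (fRDP k)) :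
    normalCoeff k e a b (xR k _ ^ n * r) = 0 := by
  obtain ⟨h, rfl⟩ := Ideal.Quotient.mk_surjective r
  rw [← map_pow, ← map_mul, normalCoeff_mk, X_pow_eq, pairing_monomial_mul]
  refine finsum_eq_zero_of_forall_eq_zero fun m => ?_
  by_contra hm
  have := (monomialCoeff_support k _ _ _ _ _ _ (left_ne_zero_of_mul hm)).1
  simp at this
  omega

lemma normalCoeff_yR_pow_mul (e a b n : ℕ) (hn : b < n) (r : Rq k (fRDP k)) :
    normalCoeff k e a b (yR k _ ^ n * r) = 0 := by
  obtain ⟨h, rfl⟩ := Ideal.Quotient.mk_surjective r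
  rw [← map_pow, ← map_mul, normalCoeff_mk, X_pow_eq, pairing_monomial_mul]
  refine finsum_eq_zero_of_forall_eq_zero fun m => ?_
  by_contra hm
  have := (monomialCoeff_support k _ _ _ _ _ _ (left_ne_zero_of_mul hm)).2.1
  simp at this
  omega

variable (k) in
/-- The ideal `(x ^ n, y ^ n)` of `R`. -/
def xyIdeal (n : ℕ) : Ideal (Rq k (fRDP k)) := Ideal.span {xR k _ ^ n, yR k _ ^ n}

lemma mem_xyIdeal {n : ℕ} {r : Rq k (fRDP k)} :
    r ∈ xyIdeal k n ↔ ∃ u v, u * xR k _ ^ n + v * yR k _ ^ n = r :=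
  Ideal.mem_span_pair

lemma normalCoeff_eq_zero_of_mem (e a b n : ℕ) (ha : a < n) (hb : b < n) {r : Rq k (fRDP k)}
    (hr : r ∈ xyIdeal k n) : normalCoeff k e a b r = 0 := by
  obtain ⟨u, v, rfl⟩ := mem_xyIdeal.1 hr
  rw [map_add, mul_comm u, mul_comm v, normalCoeff_xR_pow_mul _ _ _ _ ha,
    normalCoeff_yR_pow_mul _ _ _ _ hb, add_zero]

lemma zR_sq : zR k (fRDP k) ^ 2 = -(xR k _ ^ 3 + yR k _ ^ 5) := by
  rw [eq_neg_iff_add_eq_zero, ← add_assoc, ← map_pow, ← map_pow, ← map_pow, ← map_add, ← map_add,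
    Ideal.Quotient.eq_zero_iff_mem]
  exact Ideal.mem_span_singleton_self _

lemma zR_pow_mem (n : ℕ) : zR k (fRDP k) ^ (4 * n) ∈ xyIdeal k n := by
  have hx : xR k (fRDP k) ^ n ∈ xyIdeal k n := Ideal.subset_span (by simp)
  have hy : yR k (fRDP k) ^ n ∈ xyIdeal k n := Ideal.subset_span (by simp)
  have h4 : zR k (fRDP k) ^ 4 = (xR k _ ^ 3 + yR k _ ^ 5) ^ 2 := by
    rw [show 4 = 2 * 2 from rfl, pow_mul, zR_sq]
    ring
  rw [pow_mul, h4, ← pow_mul]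
  refine Ideal.add_pow_mem_of_pow_mem_of_le (m := n) (n := n) _ ?_ ?_ (by omega)
  · rw [← pow_mul, mul_comm, pow_mul]
    exact Ideal.pow_mem_of_mem _ hx _ (by norm_num)
  · rw [← pow_mul, mul_comm, pow_mul]
    exact Ideal.pow_mem_of_mem _ hy _ (by norm_num)

/-- A power series is a combination of finitely many monomials and of multiples of given powers
of the variables. -/
lemma exists_eq_sum_add (h : PS k) (n M : ℕ) :
    ∃ (s : Finset (Fin 3 →₀ ℕ)) (u v w : PS k), h = ∑ m ∈ s, monomial m (coeff m h) +
      (u * X 0 ^ n + v * X 1 ^ n + w * X 2 ^ M) := by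
  classical
  let s := Finset.Iic (Finsupp.equivFunOnFinite.symm ![n, n, M])
  have hs (m : Fin 3 →₀ ℕ) (h0 : m 0 < n) (h1 : m 1 < n) (h2 : m 2 < M) : m ∈ s := by
    rw [Finset.mem_Iic]
    intro i
    fin_cases i
    exacts [h0.le, h1.le, h2.le]
  obtain ⟨u, hu⟩ : (X 0 : PS k) ^ n ∣
      (fun m => if m ∉ s ∧ n ≤ m 0 then coeff m h else 0 : PS k) :=
    X_pow_dvd_iff.2 fun m hm => if_neg fun hm' => by omega
  obtain ⟨v, hv⟩ : (X 1 : PS k) ^ n ∣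
      (fun m => if m ∉ s ∧ m 0 < n ∧ n ≤ m 1 then coeff m h else 0 : PS k) :=
    X_pow_dvd_iff.2 fun m hm => if_neg fun hm' => by omega
  obtain ⟨w, hw⟩ : (X 2 : PS k) ^ M ∣
      (fun m => if m ∉ s ∧ m 0 < n ∧ m 1 < n then coeff m h else 0 : PS k) :=
    X_pow_dvd_iff.2 fun m hm => if_neg fun hm' => hm'.1 (hs m hm'.2.1 hm'.2.2 hm)
  refine ⟨s, u, v, w, ?_⟩
  rw [mul_comm u, mul_comm v, mul_comm w, ← hu, ← hv, ← hw]
  ext m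
  simp only [map_add, map_sum, coeff_monomial, Finset.sum_ite_eq]
  change coeff m h = _ + ((if m ∉ s ∧ n ≤ m 0 then coeff m h else 0) +
    (if m ∉ s ∧ m 0 < n ∧ n ≤ m 1 then coeff m h else 0) +
    (if m ∉ s ∧ m 0 < n ∧ m 1 < n then coeff m h else 0))
  by_cases h1 : m ∈ s <;> by_cases h2 : m 0 < n <;> by_cases h3 : m 1 < n <;>
    simp [h1, h2, h3, not_le.2, not_lt.1]

/-- An additive subgroup of `R` that contains some ideal `(x ^ n, y ^ n)` and all multiples of
monomials in normal form is everything. -/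
lemma mem_of_normal_monomials (W : AddSubgroup (Rq k (fRDP k))) (n : ℕ)
    (hn : ∀ r ∈ xyIdeal k n, r ∈ W)
    (hW : ∀ (c : k) (a b e : ℕ), e ≤ 1 →
      c • (xR k (fRDP k) ^ a * yR k (fRDP k) ^ b * zR k (fRDP k) ^ e) ∈ W)
    (r : Rq k (fRDP k)) : r ∈ W := by
  have hmon (c : k) (C A B : ℕ) :
      c • (xR k (fRDP k) ^ A * yR k (fRDP k) ^ B * zR k (fRDP k) ^ C) ∈ W := by
    induction C using Nat.twoStepInduction generalizing A B with
    | zero => exact hW c A B 0 zero_le_one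
    | one => exact hW c A B 1 le_rfl
    | more C ih _ =>
      have : xR k (fRDP k) ^ A * yR k (fRDP k) ^ B * zR k (fRDP k) ^ (C + 2) =
          -(xR k (fRDP k) ^ (A + 3) * yR k (fRDP k) ^ B * zR k (fRDP k) ^ C) -
          xR k (fRDP k) ^ A * yR k (fRDP k) ^ (B + 5) * zR k (fRDP k) ^ C := by
        rw [pow_add _ C 2, zR_sq]
        ring
      rw [this, smul_sub, smul_neg]
      exact W.sub_mem (W.neg_mem (ih _ _)) (ih _ _)
  obtain ⟨h, rfl⟩ := Ideal.Quotient.mk_surjective r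
  obtain ⟨s, u, v, w, hh⟩ := exists_eq_sum_add h n (4 * n)
  rw [hh, map_add, map_sum]
  refine W.add_mem (W.sum_mem fun m _ => ?_) (hn _ ?_)
  · convert hmon (coeff m h) (m 2) (m 0) (m 1) using 1
    have : monomial m (coeff m h) = coeff m h • ((X 0 : PS k) ^ m 0 * X 1 ^ m 1 * X 2 ^ m 2) := by
      rw [X_pow_eq, X_pow_eq, X_pow_eq, monomial_mul_monomial, monomial_mul_monomial,
        ← map_smul]
      congr 1
      · congr 1
        ext i
        fin_cases i <;> simp
      · simp
    rw [this]
    rfl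
  · rw [map_add, map_add, map_mul, map_mul, map_mul, map_pow, map_pow, map_pow]
    refine Ideal.add_mem _ (mem_xyIdeal.2 ⟨_, _, rfl⟩) (Ideal.mul_mem_left _ _ (zR_pow_mem n))

lemma normalCoeff_smul_monomial (e a b A B C : ℕ) (c : k) :
    normalCoeff k e a b (c • (xR k _ ^ A * yR k _ ^ B * zR k _ ^ C)) =
      c * monomialCoeff k e a b C A B := by
  rw [map_smul, normalCoeff_monomial, smul_eq_mul]

lemma monomialCoeff_of_le_one {e' : ℕ} (he' : e' ≤ 1) (e a b A B : ℕ) :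
    monomialCoeff k e a b e' A B = if e = e' ∧ A = a ∧ B = b then 1 else 0 := by
  interval_cases e' <;> rfl

lemma mem_xyIdeal_iff_normalCoeff {n : ℕ} {r : Rq k (fRDP k)} :
    r ∈ xyIdeal k n ↔ ∀ e ≤ 1, ∀ a < n, ∀ b < n, normalCoeff k e a b r = 0 := by
  refine ⟨fun hr e _ a ha b hb => normalCoeff_eq_zero_of_mem e a b n ha hb hr, fun hr => ?_⟩
  let N : Rq k (fRDP k) →ₗ[k] Rq k (fRDP k) :=
    ∑ e ∈ Finset.range 2, ∑ a ∈ Finset.range n, ∑ b ∈ Finset.range n,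
      (normalCoeff k e a b).smulRight (xR k _ ^ a * yR k _ ^ b * zR k _ ^ e)
  have hN (r : Rq k (fRDP k)) : N r = ∑ e ∈ Finset.range 2, ∑ a ∈ Finset.range n,
      ∑ b ∈ Finset.range n, normalCoeff k e a b r • (xR k _ ^ a * yR k _ ^ b * zR k _ ^ e) := by
    simp [N, LinearMap.sum_apply]
  have hN0 (r : Rq k (fRDP k)) (h : ∀ e ≤ 1, ∀ a < n, ∀ b < n, normalCoeff k e a b r = 0) :
      N r = 0 := by
    rw [hN]
    refine Finset.sum_eq_zero fun e he => Finset.sum_eq_zero fun a ha =>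
      Finset.sum_eq_zero fun b hb => ?_
    rw [Finset.mem_range] at he ha hb
    rw [h e (by omega) a ha b hb, zero_smul]
  have hI (r : Rq k (fRDP k)) (hr : r ∈ xyIdeal k n) : r - N r ∈ xyIdeal k n := by
    rwa [hN0 r fun e _ a ha b hb => normalCoeff_eq_zero_of_mem e a b n ha hb hr, sub_zero]
  have key := mem_of_normal_monomials
    ((xyIdeal k n).toAddSubgroup.comap (LinearMap.id - N).toAddMonoidHom) n hI ?_ r
  · change r - N r ∈ xyIdeal k n at key
    rwa [hN0 r hr, sub_zero] at key
  · intro c a b e he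
    change c • (xR k (fRDP k) ^ a * yR k _ ^ b * zR k _ ^ e) -
      N (c • (xR k (fRDP k) ^ a * yR k _ ^ b * zR k _ ^ e)) ∈ xyIdeal k n
    by_cases ha : a < n
    · by_cases hb : b < n
      · convert (xyIdeal k n).zero_mem
        have hval (e' a' b' : ℕ) :
            normalCoeff k e' a' b' (c • (xR k (fRDP k) ^ a * yR k _ ^ b * zR k _ ^ e)) =
              if e' = e ∧ a = a' ∧ b = b' then c else 0 := by
          rw [normalCoeff_smul_monomial, monomialCoeff_of_le_one he, mul_ite, mul_one, mul_zero]
        rw [sub_eq_zero, hN]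
        simp only [hval]
        rw [Finset.sum_eq_single_of_mem e (by rw [Finset.mem_range]; omega),
          Finset.sum_eq_single_of_mem a (Finset.mem_range.2 ha),
          Finset.sum_eq_single_of_mem b (Finset.mem_range.2 hb)]
        · rw [if_pos ⟨rfl, rfl, rfl⟩]
        · intro b' _ hb'
          rw [if_neg (by omega), zero_smul]
        · intro a' _ ha'
          refine Finset.sum_eq_zero fun b' _ => ?_
          rw [if_neg (by omega), zero_smul]
        · intro e' _ he'
          refine Finset.sum_eq_zero fun a' _ => Finset.sum_eq_zero fun b' _ => ?_
          rw [if_neg (by omega), zero_smul]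
      · refine hI _ (mem_xyIdeal.2
          ⟨0, c • (xR k _ ^ a * yR k _ ^ (b - n) * zR k _ ^ e), ?_⟩)
        rw [zero_mul, zero_add, smul_mul_assoc]
        conv_rhs => rw [← Nat.sub_add_cancel (not_lt.1 hb), pow_add]
        congr 1
        ring
    · refine hI _ (mem_xyIdeal.2
        ⟨c • (xR k _ ^ (a - n) * yR k _ ^ b * zR k _ ^ e), 0, ?_⟩)
      rw [zero_mul, add_zero, smul_mul_assoc]
      conv_rhs => rw [← Nat.sub_add_cancel (not_lt.1 ha), pow_add]
      congr 1
      ring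

lemma normalCoeff_mul_pow_mul (e a b K : ℕ) (r : Rq k (fRDP k)) :
    normalCoeff k e (a + K) (b + K) ((xR k _ * yR k _) ^ K * r) = normalCoeff k e a b r := by
  refine mem_of_normal_monomials (AddMonoidHom.eqLocus
    ((normalCoeff k e (a + K) (b + K)).toAddMonoidHom.comp
      (AddMonoidHom.mulLeft ((xR k _ * yR k _) ^ K)))
    (normalCoeff k e a b).toAddMonoidHom) (a + b + 1) ?_ ?_ r
  · intro r hr
    change normalCoeff k e (a + K) (b + K) ((xR k _ * yR k _) ^ K * r) = normalCoeff k e a b r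
    rw [normalCoeff_eq_zero_of_mem e a b _ (by omega) (by omega) hr]
    refine normalCoeff_eq_zero_of_mem e _ _ (a + b + 1 + K) (by omega) (by omega) ?_
    obtain ⟨u, v, rfl⟩ := mem_xyIdeal.1 hr
    exact mem_xyIdeal.2 ⟨u * yR k _ ^ K, v * xR k _ ^ K, by ring⟩
  · intro c A B C hC
    change normalCoeff k e (a + K) (b + K) ((xR k _ * yR k _) ^ K *
      (c • (xR k _ ^ A * yR k _ ^ B * zR k _ ^ C))) =
      normalCoeff k e a b (c • (xR k _ ^ A * yR k _ ^ B * zR k _ ^ C))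
    have : (xR k (fRDP k) * yR k _) ^ K * (c • (xR k _ ^ A * yR k _ ^ B * zR k _ ^ C)) =
        c • (xR k _ ^ (A + K) * yR k _ ^ (B + K) * zR k _ ^ C) := by
      rw [mul_smul_comm]
      congr 1
      ring
    rw [this, normalCoeff_smul_monomial, normalCoeff_smul_monomial, monomialCoeff_of_le_one hC,
      monomialCoeff_of_le_one hC]
    simp

lemma mul_pow_mul_mem_xyIdeal_iff {n K : ℕ} {r : Rq k (fRDP k)} :
    (xR k _ * yR k _) ^ K * r ∈ xyIdeal k (n + K) ↔ r ∈ xyIdeal k n := by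
  constructor
  · intro h
    rw [mem_xyIdeal_iff_normalCoeff]
    intro e _ a ha b hb
    rw [← normalCoeff_mul_pow_mul e a b K]
    exact normalCoeff_eq_zero_of_mem _ _ _ _ (by omega) (by omega) h
  · intro h
    obtain ⟨u, v, rfl⟩ := mem_xyIdeal.1 h
    exact mem_xyIdeal.2 ⟨u * yR k _ ^ K, v * xR k _ ^ K, by ring⟩

instance : Nontrivial (Rq k (fRDP k)) := by
  refine ⟨⟨1, 0, fun h => one_ne_zero (α := k) ?_⟩⟩
  have h1 := normalCoeff_monomial (k := k) 0 0 0 0 0 0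
  simpa [h, monomialCoeff] using h1.symm

instance [CharP k 5] : CharP (Rq k (fRDP k)) 5 :=
  charP_of_injective_algebraMap (algebraMap k _).injective 5

instance fact_prime_five : Fact (Nat.Prime 5) := ⟨by norm_num⟩

lemma pow_five_mem_xyIdeal [CharP k 5] {n : ℕ} {r : Rq k (fRDP k)} (hr : r ∈ xyIdeal k n) :
    r ^ 5 ∈ xyIdeal k (5 * n) := by
  obtain ⟨u, v, rfl⟩ := mem_xyIdeal.1 hr
  rw [add_pow_char]
  exact mem_xyIdeal.2 ⟨u ^ 5, v ^ 5, by ring⟩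

/-- Comparison of the coefficients of `r ^ 5` with those of `r`, reduced to monomials. -/
lemma normalCoeff_pow_five [CharP k 5] (e a b e' a' b' : ℕ) (t : k)
    (h : ∀ C ≤ 1, ∀ A B, monomialCoeff k e' a' b' (5 * C) (5 * A) (5 * B) =
      t * monomialCoeff k e a b C A B ^ 5) (r : Rq k (fRDP k)) :
    normalCoeff k e' a' b' (r ^ 5) = t * normalCoeff k e a b r ^ 5 := by
  refine mem_of_normal_monomials (AddMonoidHom.eqLocus
    ((normalCoeff k e' a' b').toAddMonoidHom.comp
      (frobenius (Rq k (fRDP k)) 5 : Rq k (fRDP k) →+ Rq k (fRDP k)))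
    (((AddMonoidHom.mulLeft t).comp (frobenius k 5 : k →+ k)).comp
      (normalCoeff k e a b).toAddMonoidHom)) (a + b + a' + b' + 1) ?_ ?_ r
  · intro r hr
    change normalCoeff k e' a' b' (r ^ 5) = t * normalCoeff k e a b r ^ 5
    rw [normalCoeff_eq_zero_of_mem e a b _ (by omega) (by omega) hr,
      normalCoeff_eq_zero_of_mem e' a' b' _ (by omega) (by omega) (pow_five_mem_xyIdeal hr)]
    simp
  · intro c A B C hC
    change normalCoeff k e' a' b' ((c • (xR k _ ^ A * yR k _ ^ B * zR k _ ^ C)) ^ 5) =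
      t * normalCoeff k e a b (c • (xR k _ ^ A * yR k _ ^ B * zR k _ ^ C)) ^ 5
    rw [smul_pow, mul_pow, mul_pow, ← pow_mul, ← pow_mul, ← pow_mul, mul_comm A, mul_comm B,
      mul_comm C, normalCoeff_smul_monomial, normalCoeff_smul_monomial, h C hC]
    ring

lemma normalCoeff_zero_pow_five [CharP k 5] (a b : ℕ) (r : Rq k (fRDP k)) :
    normalCoeff k 0 (5 * a) (5 * b) (r ^ 5) = normalCoeff k 0 a b r ^ 5 := by
  rw [normalCoeff_pow_five 0 a b _ _ _ 1, one_mul]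
  intro C hC A B
  interval_cases C <;> simp [monomialCoeff]

lemma normalCoeff_one_pow_five [CharP k 5] (a b : ℕ) (r : Rq k (fRDP k)) :
    normalCoeff k 1 (5 * a + 6) (5 * b) (r ^ 5) = normalCoeff k 1 a b r ^ 5 := by
  rw [normalCoeff_pow_five 1 a b _ _ _ 1, one_mul]
  intro C hC A B
  interval_cases C
  · simp [monomialCoeff]
  · have h1 : 5 * A ≠ 5 * a + 3 := by omega
    have h2 : 5 * A ≠ 5 * a + 6 := by omega
    simp [monomialCoeff, h1, h2]

lemma normalCoeff_one_pow_five' [CharP k 5] (a b : ℕ) (r : Rq k (fRDP k)) :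
    normalCoeff k 1 (5 * a + 3) (5 * b + 5) (r ^ 5) = 2 * normalCoeff k 1 a b r ^ 5 := by
  rw [normalCoeff_pow_five 1 a b _ _ _ 2]
  intro C hC A B
  interval_cases C
  · simp [monomialCoeff]
  · have h1 : 5 * A + 3 ≠ 5 * a := by omega
    have h2 : 5 * A ≠ 5 * a + 3 := by omega
    by_cases h : A = a ∧ B = b <;> simp [monomialCoeff, h1, h2, h]
    norm_num

lemma normalCoeff_one_pow_five_eq_zero [CharP k 5] (a b : ℕ) (r : Rq k (fRDP k)) :
    normalCoeff k 1 (5 * a + 4) b (r ^ 5) = 0 := by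
  rw [normalCoeff_pow_five 1 a b _ _ _ 0, zero_mul]
  intro C hC A B
  interval_cases C
  · simp [monomialCoeff]
  · have h1 : 5 * A + 2 ≠ 5 * a := by omega
    have h2 : 5 * A ≠ 5 * a + 4 := by omega
    have h3 : 5 * A ≠ 5 * a + 1 := by omega
    simp [monomialCoeff, h1, h2, h3]

variable (k) in
/-- The canonical map from `R` to `L`. -/
abbrev toL : Rq k (fRDP k) →+* Lloc k (fRDP k) := algebraMap _ _

lemma smul_eq_toL_mul (r : Rq k (fRDP k)) (c : Lloc k (fRDP k)) : r • c = toL k r * c :=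
  Algebra.smul_def (R := Rq k (fRDP k)) (A := Lloc k (fRDP k)) r c

lemma isUnit_toL_xR_mul_yR : IsUnit (toL k (xR k _ * yR k _)) :=
  IsLocalization.Away.algebraMap_isUnit _

lemma phiX_algebraMap (r : Rq k (fRDP k)) : phiX k _ (algebraMap _ _ r) = toL k r :=
  IsLocalization.Away.awayToAwayRight_eq _ _ _

lemma phiY_algebraMap (r : Rq k (fRDP k)) : phiY k _ (algebraMap _ _ r) = toL k r := by
  unfold phiY
  exact IsLocalization.Away.awayToAwayLeft_eq _ _ _

lemma mem_Asub_iff {c : Lloc k (fRDP k)} :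
    c ∈ Asub k (fRDP k) ↔
      ∃ N, ∃ w ∈ xyIdeal k N, c * toL k (xR k _ * yR k _) ^ N = toL k w := by
  constructor
  · intro hc
    induction hc using Submodule.span_induction with
    | mem c hc =>
      rcases hc with ⟨q, rfl⟩ | ⟨q, rfl⟩
      · obtain ⟨N, u, hu⟩ := IsLocalization.Away.surj (xR k (fRDP k)) q
        refine ⟨N, u * yR k _ ^ N, mem_xyIdeal.2 ⟨0, u, by ring⟩, ?_⟩
        have := congrArg (phiX k _) hu
        rw [map_mul, map_pow, phiX_algebraMap, phiX_algebraMap] at this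
        rw [map_mul, map_mul, map_pow, ← this]
        ring
      · obtain ⟨N, u, hu⟩ := IsLocalization.Away.surj (yR k (fRDP k)) q
        refine ⟨N, u * xR k _ ^ N, mem_xyIdeal.2 ⟨u, 0, by ring⟩, ?_⟩
        have := congrArg (phiY k _) hu
        rw [map_mul, map_pow, phiY_algebraMap, phiY_algebraMap] at this
        rw [map_mul, map_mul, map_pow, ← this]
        ring
    | zero => exact ⟨0, 0, Ideal.zero_mem _, by simp⟩
    | add c d _ _ hc hd =>
      obtain ⟨N, w, hw, h⟩ := hc
      obtain ⟨N', w', hw', h'⟩ := hd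
      refine ⟨N + N', (xR k _ * yR k _) ^ N' * w + (xR k _ * yR k _) ^ N * w',
        Ideal.add_mem _ (mul_pow_mul_mem_xyIdeal_iff.2 hw) ?_, ?_⟩
      · rw [add_comm N]
        exact mul_pow_mul_mem_xyIdeal_iff.2 hw'
      · rw [map_add, map_mul (toL k) (_ ^ _), map_mul (toL k) (_ ^ _), map_pow, map_pow, ← h, ← h']
        ring
    | smul r c _ hc =>
      obtain ⟨N, w, hw, h⟩ := hc
      refine ⟨N, r * w, Ideal.mul_mem_left _ _ hw, ?_⟩
      rw [map_mul (toL k) r, ← h, smul_eq_toL_mul, mul_assoc]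
  · rintro ⟨N, w, hw, h⟩
    obtain ⟨u, v, rfl⟩ := mem_xyIdeal.1 hw
    obtain ⟨q, hq⟩ := IsLocalization.Away.algebraMap_isUnit
      (S := Localization.Away (yR k (fRDP k))) (yR k (fRDP k))
    obtain ⟨p, hp⟩ := IsLocalization.Away.algebraMap_isUnit
      (S := Localization.Away (xR k (fRDP k))) (xR k (fRDP k))
    have hc : c = phiX k _ (algebraMap _ _ v * (↑p⁻¹ : Localization.Away (xR k (fRDP k))) ^ N) +
        phiY k _ (algebraMap _ _ u * (↑q⁻¹ : Localization.Away (yR k (fRDP k))) ^ N) := by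
      have hp' : phiX k _ (↑p⁻¹ : Localization.Away (xR k (fRDP k))) * toL k (xR k _) = 1 := by
        rw [← phiX_algebraMap, ← hp, ← map_mul, Units.inv_mul, map_one]
      have hq' : phiY k _ (↑q⁻¹ : Localization.Away (yR k (fRDP k))) * toL k (yR k _) = 1 := by
        rw [← phiY_algebraMap, ← hq, ← map_mul, Units.inv_mul, map_one]
      rw [← (isUnit_toL_xR_mul_yR.pow N).mul_left_inj, h, map_mul (phiX k _), map_mul (phiY k _),
        phiX_algebraMap, phiY_algebraMap, map_pow, map_pow]
      rw [map_add, map_mul, map_mul, map_mul, map_pow, map_pow]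
      have hpN := congrArg (· ^ N) hp'
      have hqN := congrArg (· ^ N) hq'
      simp only [mul_pow, one_pow] at hpN hqN
      linear_combination (-toL k v * toL k (yR k _) ^ N) * hpN -
        (toL k u * toL k (xR k _) ^ N) * hqN
    rw [hc]
    exact Submodule.add_mem _ (Submodule.subset_span (Or.inl ⟨_, rfl⟩))
      (Submodule.subset_span (Or.inr ⟨_, rfl⟩))

/-- Membership in `A` of a fraction `r / (x * y) ^ n`. -/
lemma mem_Asub_iff_mem_xyIdeal {c : Lloc k (fRDP k)} {n : ℕ} {r : Rq k (fRDP k)}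
    (h : c * toL k (xR k _ * yR k _) ^ n = toL k r) :
    c ∈ Asub k (fRDP k) ↔ r ∈ xyIdeal k n := by
  refine ⟨fun hc => ?_, fun hr => mem_Asub_iff.2 ⟨n, r, hr, h⟩⟩
  obtain ⟨N, w, hw, h'⟩ := mem_Asub_iff.1 hc
  have heq : toL k ((xR k _ * yR k _) ^ N * r) = toL k ((xR k _ * yR k _) ^ n * w) := by
    rw [map_mul, map_mul, map_pow, map_pow, ← h, ← h']
    ring
  obtain ⟨M, hM⟩ := IsLocalization.Away.exists_of_eq (xR k (fRDP k) * yR k (fRDP k)) heq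
  rw [← mul_pow_mul_mem_xyIdeal_iff (K := M + N), pow_add, mul_assoc, hM, ← mul_assoc, ← pow_add,
    show n + (M + N) = N + (M + n) by ring]
  exact mul_pow_mul_mem_xyIdeal_iff.2 hw

lemma zxy_mul : zxy k (fRDP k) * toL k (xR k _ * yR k _) = toL k (zR k _) := by
  rw [zxy, Localization.mk_eq_mk']
  exact IsLocalization.mk'_spec _ _ _

lemma toL_smul (t : k) (r : Rq k (fRDP k)) :
    toL k (t • r) = toL k (algebraMap k _ t) * toL k r :=
  (congrArg (toL k) (Algebra.smul_def (R := k) (A := Rq k (fRDP k)) t r)).trans (map_mul (toL k) _ _)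

/-- A fraction killed by Frobenius modulo `A` is a multiple of `z / (x * y)` modulo `A`. -/
lemma exists_sub_smul_zxy_mem [CharP k 5] {c : Lloc k (fRDP k)}
    (hc : c ^ 5 ∈ Asub k (fRDP k)) :
    ∃ a : k, c - algebraMap k (Rq k (fRDP k)) a • zxy k (fRDP k) ∈ Asub k (fRDP k) := by
  obtain ⟨n, r, h⟩ := IsLocalization.Away.surj (xR k (fRDP k) * yR k (fRDP k)) c
  replace h : c * toL k (xR k _ * yR k _) ^ (n + 1) = toL k (r * (xR k _ * yR k _)) := by
    rw [pow_succ, ← mul_assoc, h, ← map_mul]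
  generalize r * (xR k _ * yR k _) = r at h
  have h5 : c ^ 5 * toL k (xR k _ * yR k _) ^ (5 * (n + 1)) = toL k (r ^ 5) := by
    rw [map_pow, ← h]
    ring
  have hr := mem_xyIdeal_iff_normalCoeff.1 ((mem_Asub_iff_mem_xyIdeal h5).1 hc)
  refine ⟨normalCoeff k 1 n n r, ?_⟩
  set t := normalCoeff k 1 n n r with ht
  have h' : (c - algebraMap k (Rq k (fRDP k)) t • zxy k (fRDP k)) *
      toL k (xR k _ * yR k _) ^ (n + 1) =
      toL k (r - t • (xR k _ ^ n * yR k _ ^ n * zR k _ ^ 1)) := by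
    rw [map_sub, ← h, toL_smul, map_mul (toL k) (_ * _), ← mul_pow, map_pow, pow_one, ← zxy_mul,
      smul_eq_toL_mul]
    ring
  rw [mem_Asub_iff_mem_xyIdeal h', mem_xyIdeal_iff_normalCoeff]
  intro e he a ha b hb
  rw [map_sub, normalCoeff_smul_monomial, monomialCoeff_of_le_one le_rfl]
  interval_cases e
  · have := hr 0 zero_le_one (5 * a) (by omega) (5 * b) (by omega)
    rw [normalCoeff_zero_pow_five] at this
    simp [pow_eq_zero_iff] at this
    simp [this]
  · have h2 : (2 : k) ≠ 0 := by
      have := (CharP.cast_eq_zero_iff k 5 2).not.2 (by norm_num)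
      exact_mod_cast this
    by_cases hab : a = n ∧ b = n
    · obtain ⟨rfl, rfl⟩ := hab
      simp [ht]
    · rw [if_neg (by omega), mul_zero, sub_zero]
      by_cases han : a = n
      · have := hr 1 le_rfl (5 * a + 3) (by omega) (5 * b + 5) (by omega)
        rw [normalCoeff_one_pow_five'] at this
        simpa [h2] using this
      · have := hr 1 le_rfl (5 * a + 6) (by omega) (5 * b) (by omega)
        rw [normalCoeff_one_pow_five] at this
        simpa using this

/-- A Frobenius image that is congruent to a multiple of `z / (x * y)` modulo `A` lies in `A`. -/
lemma pow_five_mem_of_sub_smul_zxy_mem [CharP k 5] {c : Lloc k (fRDP k)} {t : k}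
    (hc : c ^ 5 - algebraMap k (Rq k (fRDP k)) t • zxy k (fRDP k) ∈ Asub k (fRDP k)) :
    c ^ 5 ∈ Asub k (fRDP k) := by
  obtain ⟨n, r, h⟩ := IsLocalization.Away.surj (xR k (fRDP k) * yR k (fRDP k)) c
  replace h : c * toL k (xR k _ * yR k _) ^ (n + 1) = toL k (r * (xR k _ * yR k _)) := by
    rw [pow_succ, ← mul_assoc, h, ← map_mul]
  generalize r * (xR k _ * yR k _) = r at h
  have h' : (c ^ 5 - algebraMap k (Rq k (fRDP k)) t • zxy k (fRDP k)) *
      toL k (xR k _ * yR k _) ^ (5 * (n + 1)) =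
      toL k (r ^ 5 - t • (xR k _ ^ (5 * n + 4) * yR k _ ^ (5 * n + 4) * zR k _ ^ 1)) := by
    rw [map_sub, map_pow, ← h, toL_smul, map_mul (toL k) (_ * _), ← mul_pow, map_pow, pow_one,
      ← zxy_mul, smul_eq_toL_mul]
    ring
  have hr := mem_xyIdeal_iff_normalCoeff.1 ((mem_Asub_iff_mem_xyIdeal h').1 hc)
  have ht := hr 1 le_rfl (5 * n + 4) (by omega) (5 * n + 4) (by omega)
  rw [map_sub, normalCoeff_one_pow_five_eq_zero, normalCoeff_smul_monomial,
    monomialCoeff_of_le_one le_rfl, if_pos ⟨rfl, rfl, rfl⟩] at ht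
  obtain rfl : t = 0 := by simpa using ht
  rwa [smul_eq_toL_mul, map_zero, map_zero, zero_mul, sub_zero] at hc

lemma zxy_notMem : zxy k (fRDP k) ∉ Asub k (fRDP k) := by
  have h : zxy k (fRDP k) * toL k (xR k _ * yR k _) ^ 1 = toL k (zR k _) := by
    rw [pow_one, zxy_mul]
  rw [mem_Asub_iff_mem_xyIdeal h, mem_xyIdeal_iff_normalCoeff]
  intro hz
  have h1 := normalCoeff_monomial (k := k) 1 0 0 0 0 1
  rw [pow_zero, pow_zero, pow_one, one_mul, one_mul,
    hz 1 le_rfl 0 zero_lt_one 0 zero_lt_one] at h1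
  simp [monomialCoeff] at h1

lemma zxy_pow_five_mem : zxy k (fRDP k) ^ 5 ∈ Asub k (fRDP k) := by
  have h : zxy k (fRDP k) ^ 5 * toL k (xR k _ * yR k _) ^ 5 = toL k (zR k _ ^ 5) := by
    rw [← mul_pow, zxy_mul, map_pow]
  rw [mem_Asub_iff_mem_xyIdeal h, mem_xyIdeal]
  refine ⟨xR k _ * zR k _, zR k _ * (2 * xR k _ ^ 3 + yR k _ ^ 5), ?_⟩
  rw [show zR k (fRDP k) ^ 5 = zR k _ * (zR k _ ^ 2) ^ 2 by ring, zR_sq]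
  ring

lemma exists_sub_smul_zxy_mem_of_pow [CharP k 5] (m : ℕ) {c : Lloc k (fRDP k)}
    (hc : c ^ 5 ^ m ∈ Asub k (fRDP k)) :
    ∃ a : k, c - algebraMap k (Rq k (fRDP k)) a • zxy k (fRDP k) ∈ Asub k (fRDP k) := by
  induction m generalizing c with
  | zero =>
    refine ⟨0, ?_⟩
    rwa [smul_eq_toL_mul, map_zero, map_zero, zero_mul, sub_zero, ← pow_one c]
  | succ m ih =>
    rw [pow_succ', pow_mul] at hc
    obtain ⟨t, ht⟩ := ih hc
    exact exists_sub_smul_zxy_mem (pow_five_mem_of_sub_smul_zxy_mem ht)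

/-- For the rational double point `R` of type E8p0 in characteristic 5,
the Frobenius-nilpotent part `H^2_m(R)[F^∞]` of local cohomology `L/A` is the one-dimensional
`k`-vector space spanned by the class of `z/(xy)`, and it is annihilated by Frobenius. -/
theorem localCohomology_E8p0 (k : Type) [Field k] [IsAlgClosed k] [CharP k 5] :
    -- (i) the image of z/(xy) in L does not lie in A
    zxy k (fRDP k) ∉ Asub k (fRDP k) ∧
    -- (ii) (z/(xy))^5 lies in A
    (zxy k (fRDP k)) ^ 5 ∈ Asub k (fRDP k) ∧
    -- (iii) every Frobenius-nilpotent class is a k-multiple of the class of z/(xy)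
    (∀ c : Lloc k (fRDP k), (∃ m : ℕ, c ^ 5 ^ m ∈ Asub k (fRDP k)) →
      ∃ a : k, c - algebraMap k (Rq k (fRDP k)) a • zxy k (fRDP k) ∈ Asub k (fRDP k)) := by
  exact ⟨zxy_notMem, zxy_pow_five_mem, fun _ ⟨m, hm⟩ => exists_sub_smul_zxy_mem_of_pow m hm⟩
end
end

section
/- Let k be an algebraically closed field of characteristic p = 2, let m ≥ 2 and 0 ≤ r ≤ m−1 be integers, and let R = k⟦x,y,z⟧/(z^2 + x^2 y + x y^m + z x y^{m−r}) (the rational double point of type D_{2m}^r in characteristic 2). Set L' := min(m−1, 2m−2r−2). With L and A as in the context: (i) for every integer j ≥ 1 with 2j−1 ≤ L' there exists m' ≥ 0 such that (z/(xy^j))^{2^{m'}} ∈ A; (ii) the images in L/A of the elements z/(xy^j), for integers j ≥ 1 with 2j−1 ≤ L', are k-linearly independent; (iii) for every c ∈ L such that c^{2^{m'}} ∈ A for some m' ≥ 0, there exist a_j ∈ k (for j ≥ 1 with 2j−1 ≤ L') such that c − Σ_j a_j·(z/(xy^j)) ∈ A. In particular, H^2_m(R)[F^∞] has k-dimension ⌊(L'+1)/2⌋.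 -/
set_option maxHeartbeats 1000000
set_option synthInstance.maxHeartbeats 400000

open MvPowerSeries

noncomputable section

variable (k : Type) [Field k]

section PowerSeries

variable {k : Type} [Field k]

theorem coeff_mul_eq_zero_of_box {a b : ℕ} (g : PS k) {h : PS k}
    (hh : ∀ m : Fin 3 →₀ ℕ, m 0 < a → m 1 < b → coeff m h = 0)
    (m : Fin 3 →₀ ℕ) (h0 : m 0 < a) (h1 : m 1 < b) : coeff m (g * h) = 0 := by
  classical
  rw [coeff_mul]
  refine Finset.sum_eq_zero fun p hp => ?_
  have hp' := Finset.HasAntidiagonal.mem_antidiagonal.mp hp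
  have e0 : p.1 0 + p.2 0 = m 0 := by rw [← hp']; rfl
  have e1 : p.1 1 + p.2 1 = m 1 := by rw [← hp']; rfl
  rw [hh p.2 (by omega) (by omega), mul_zero]

theorem coeff_eq_zero_of_coeff_mul {n : ℕ} (g h : PS k)
    (hfh : ∀ m : Fin 3 →₀ ℕ, m 0 < n → m 1 < n → 2 ≤ m 2 →
      coeff m ((X 2 ^ 2 + X 0 * g) * h) = 0) (a : ℕ) (ha : a ≤ n) :
    ∀ m : Fin 3 →₀ ℕ, m 0 < a → m 1 < n → coeff m h = 0 := by
  classical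
  induction a with
  | zero => intro m h0; omega
  | succ a ih =>
    intro m h0 h1
    have key := hfh (Finsupp.single 2 2 + m) (by simp; omega) (by simpa using h1) (by simp)
    have hz : coeff (Finsupp.single 2 2 + m) (X 0 * (g * h)) = 0 := by
      rw [X, coeff_monomial_mul]
      split_ifs with hle
      · rw [one_mul]
        have hpos : 1 ≤ m 0 := by simpa using hle 0
        refine coeff_mul_eq_zero_of_box g (ih (by omega)) _ ?_ ?_
        · simp; omega
        · simpa using h1
      · rfl
    rw [add_mul, mul_assoc, map_add, hz, add_zero, X_pow_eq, coeff_add_monomial_mul,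
      one_mul] at key
    exact key

/-- Reduced representatives modulo `(x ^ n, y ^ n, f)`, with `f` of the form `z ^ 2 + x * g`,
are unique. -/
theorem coeff_eq_zero_of_eq {n : ℕ} (g : PS k) {G p q h : PS k}
    (hG : G = X 0 ^ n * p + X 1 ^ n * q + (X 2 ^ 2 + X 0 * g) * h)
    (hz : ∀ m : Fin 3 →₀ ℕ, 2 ≤ m 2 → coeff m G = 0)
    (m : Fin 3 →₀ ℕ) (h0 : m 0 < n) (h1 : m 1 < n) : coeff m G = 0 := by
  have hx : ∀ m : Fin 3 →₀ ℕ, m 0 < n → coeff m (X 0 ^ n * p) = 0 :=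
    X_pow_dvd_iff.mp (Dvd.intro _ rfl)
  have hy : ∀ m : Fin 3 →₀ ℕ, m 1 < n → coeff m (X 1 ^ n * q) = 0 :=
    X_pow_dvd_iff.mp (Dvd.intro _ rfl)
  have hc : ∀ m : Fin 3 →₀ ℕ, m 0 < n → m 1 < n →
      coeff m G = coeff m ((X 2 ^ 2 + X 0 * g) * h) := fun m h0 h1 => by
    rw [hG, map_add, map_add, hx m h0, hy m h1, zero_add, zero_add]
  have hh := coeff_eq_zero_of_coeff_mul g h
    (fun m h0 h1 h2 => by rw [← hc m h0 h1, hz m h2]) n le_rfl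
  rw [hc m h0 h1]
  exact coeff_mul_eq_zero_of_box _ hh m h0 h1

theorem exists_eq_C_add_C_mul_X_add (φ : PS k) : ∃ (α β : k) (u v w : PS k),
    φ = C α + C β * X 2 + X 0 * u + X 1 * v + X 2 ^ 2 * w := by
  classical
  let ψ (P : (Fin 3 →₀ ℕ) → Prop) : PS k := fun m => if P m then coeff m φ else 0
  have hψ (P : (Fin 3 →₀ ℕ) → Prop) (m) : coeff m (ψ P) = if P m then coeff m φ else 0 := rfl
  obtain ⟨u, hu⟩ : X 0 ∣ ψ (fun m => m 0 ≠ 0) :=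
    X_dvd_iff.mpr fun m hm => by rw [hψ]; simp [hm]
  obtain ⟨v, hv⟩ : X 1 ∣ ψ (fun m => m 0 = 0 ∧ m 1 ≠ 0) :=
    X_dvd_iff.mpr fun m hm => by rw [hψ]; simp [hm]
  obtain ⟨w, hw⟩ : X 2 ^ 2 ∣ ψ (fun m => m 0 = 0 ∧ m 1 = 0 ∧ 2 ≤ m 2) :=
    X_pow_dvd_iff.mpr fun m hm => by rw [hψ, if_neg]; omega
  refine ⟨coeff 0 φ, coeff (Finsupp.single 2 1) φ, u, v, w, ?_⟩
  rw [← hu, ← hv, ← hw]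
  ext m
  simp only [map_add, hψ, coeff_C_mul, coeff_X, coeff_C]
  have hm0 : m = 0 ↔ m 0 = 0 ∧ m 1 = 0 ∧ m 2 = 0 := by
    simp [Finsupp.ext_iff, Fin.forall_fin_succ]
  have hm1 : m = Finsupp.single 2 1 ↔ m 0 = 0 ∧ m 1 = 0 ∧ m 2 = 1 := by
    simp [Finsupp.ext_iff, Fin.forall_fin_succ, Finsupp.single_apply]
  by_cases h0 : m 0 = 0
  · by_cases h1 : m 1 = 0
    · by_cases h2 : m 2 = 0
      · obtain rfl := hm0.mpr ⟨h0, h1, h2⟩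
        simp [Finsupp.ext_iff, Finsupp.single_apply]
      · by_cases h3 : m 2 = 1
        · obtain rfl := hm1.mpr ⟨h0, h1, h3⟩
          simp
        · have h4 : 2 ≤ m 2 := by omega
          simp [hm0, hm1, h0, h1, h2, h3, h4]
    · simp [hm0, hm1, h0, h1]
  · simp [hm0, hm1, h0]

end PowerSeries

section Cech

variable {k : Type} [Field k] (f : PS k)

/-- The image of `x` in `L`. -/
abbrev xL : Lloc k f := algebraMap (Rq k f) (Lloc k f) (xR k f)
/-- The image of `y` in `L`. -/
abbrev yL : Lloc k f := algebraMap (Rq k f) (Lloc k f) (yR k f)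
/-- The image of `z` in `L`. -/
abbrev zL : Lloc k f := algebraMap (Rq k f) (Lloc k f) (zR k f)

/-- The inverse of `x` in `L`. -/
def xInv : Lloc k f := Localization.mk (yR k f) ⟨xR k f * yR k f, Submonoid.mem_powers _⟩
/-- The inverse of `y` in `L`. -/
def yInv : Lloc k f := Localization.mk (xR k f) ⟨xR k f * yR k f, Submonoid.mem_powers _⟩

theorem xL_mul_xInv : xL f * xInv f = 1 := by
  rw [xInv, Localization.mk_eq_mk', IsLocalization.mul_mk'_eq_mk'_of_mul]
  exact IsLocalization.mk'_self _ (Submonoid.mem_powers _)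

theorem yL_mul_yInv : yL f * yInv f = 1 := by
  rw [yInv, Localization.mk_eq_mk', IsLocalization.mul_mk'_eq_mk'_of_mul, mul_comm (yR k f)]
  exact IsLocalization.mk'_self _ (Submonoid.mem_powers _)

theorem xL_pow_mul_xInv_pow (n : ℕ) : xL f ^ n * xInv f ^ n = 1 := by
  rw [← mul_pow, xL_mul_xInv, one_pow]

theorem yL_pow_mul_yInv_pow (n : ℕ) : yL f ^ n * yInv f ^ n = 1 := by
  rw [← mul_pow, yL_mul_yInv, one_pow]

theorem fcls_eq {j : ℕ} (hj : 1 ≤ j) : fcls k f j = zL f * xInv f * yInv f ^ j := by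
  obtain ⟨i, rfl⟩ := Nat.exists_eq_add_of_le' hj
  rw [fcls, Localization.mk_eq_mk', IsLocalization.mk'_eq_iff_eq_mul, Nat.add_sub_cancel]
  simp only [map_mul, map_pow]
  linear_combination (-zL f * xL f ^ i) * xL_mul_xInv f
    - (zL f * xL f ^ i * (xL f * xInv f)) * yL_pow_mul_yInv_pow f (i + 1)

theorem exists_eq_mul_xInv_pow (w : Localization.Away (xR k f)) :
    ∃ (g : Rq k f) (s : ℕ), phiX k f w = algebraMap _ _ g * xInv f ^ s := by
  obtain ⟨s, g, h⟩ := IsLocalization.Away.surj (xR k f) w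
  refine ⟨g, s, ?_⟩
  have h' := congrArg (phiX k f) h
  rw [map_mul, map_pow] at h'
  simp only [phiX, IsLocalization.Away.awayToAwayRight_eq] at h' ⊢
  rw [← h', mul_assoc, xL_pow_mul_xInv_pow, mul_one]

theorem exists_eq_mul_yInv_pow (w : Localization.Away (yR k f)) :
    ∃ (g : Rq k f) (s : ℕ), phiY k f w = algebraMap _ _ g * yInv f ^ s := by
  obtain ⟨s, g, h⟩ := IsLocalization.Away.surj (yR k f) w
  refine ⟨g, s, ?_⟩
  have h' := congrArg (phiY k f) h
  rw [map_mul, map_pow] at h'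
  simp only [phiY, IsLocalization.Away.awayToAwayLeft_eq] at h' ⊢
  rw [← h', mul_assoc, yL_pow_mul_yInv_pow, mul_one]

theorem mul_xInv_pow_mem (g : Rq k f) (s : ℕ) :
    algebraMap _ _ g * xInv f ^ s ∈ Asub k f := by
  refine Submodule.subset_span (Or.inl ⟨algebraMap _ _ g *
    IsLocalization.Away.invSelf (S := Localization.Away (xR k f)) (xR k f) ^ s, ?_⟩)
  have h := congrArg (phiX k f)
    (IsLocalization.Away.mul_invSelf (S := Localization.Away (xR k f)) (xR k f))
  rw [map_mul, map_one] at h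
  rw [map_mul, map_pow]
  simp only [phiX, IsLocalization.Away.awayToAwayRight_eq] at h ⊢
  rw [eq_comm, ← left_inv_eq_right_inv (mul_comm _ _ |>.trans (xL_mul_xInv f)) h]

theorem mul_yInv_pow_mem (g : Rq k f) (s : ℕ) :
    algebraMap _ _ g * yInv f ^ s ∈ Asub k f := by
  refine Submodule.subset_span (Or.inr ⟨algebraMap _ _ g *
    IsLocalization.Away.invSelf (S := Localization.Away (yR k f)) (yR k f) ^ s, ?_⟩)
  have h := congrArg (phiY k f)
    (IsLocalization.Away.mul_invSelf (S := Localization.Away (yR k f)) (yR k f))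
  rw [map_mul, map_one] at h
  rw [map_mul, map_pow]
  simp only [phiY, IsLocalization.Away.awayToAwayLeft_eq] at h ⊢
  rw [eq_comm, ← left_inv_eq_right_inv (mul_comm _ _ |>.trans (yL_mul_yInv f)) h]

theorem mem_Asub_iff_s6 {c : Lloc k f} : c ∈ Asub k f ↔ ∃ (g h : Rq k f) (s : ℕ),
    c = algebraMap _ _ g * xInv f ^ s + algebraMap _ _ h * yInv f ^ s := by
  constructor
  · intro hc
    induction hc using Submodule.span_induction with
    | mem c hc =>
      rcases hc with ⟨w, rfl⟩ | ⟨w, rfl⟩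
      · obtain ⟨g, s, h⟩ := exists_eq_mul_xInv_pow f w
        exact ⟨g, 0, s, by rw [h, map_zero, zero_mul, add_zero]⟩
      · obtain ⟨g, s, h⟩ := exists_eq_mul_yInv_pow f w
        exact ⟨0, g, s, by rw [h, map_zero, zero_mul, zero_add]⟩
    | zero => exact ⟨0, 0, 0, by simp⟩
    | add c d _ _ hc hd =>
      obtain ⟨g, h, s, rfl⟩ := hc
      obtain ⟨g', h', t, rfl⟩ := hd
      refine ⟨g * xR k f ^ t + g' * xR k f ^ s, h * yR k f ^ t + h' * yR k f ^ s, s + t, ?_⟩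
      simp only [map_add, map_mul, map_pow]
      linear_combination
        (-algebraMap (Rq k f) (Lloc k f) g * xInv f ^ s) * xL_pow_mul_xInv_pow f t
        - (algebraMap (Rq k f) (Lloc k f) g' * xInv f ^ t) * xL_pow_mul_xInv_pow f s
        - (algebraMap (Rq k f) (Lloc k f) h * yInv f ^ s) * yL_pow_mul_yInv_pow f t
        - (algebraMap (Rq k f) (Lloc k f) h' * yInv f ^ t) * yL_pow_mul_yInv_pow f s
    | smul r c _ hc =>
      obtain ⟨g, h, s, rfl⟩ := hc
      refine ⟨r * g, r * h, s, (Algebra.smul_def r _).trans ?_⟩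
      rw [map_mul, map_mul]
      ring
  · rintro ⟨g, h, s, rfl⟩
    exact add_mem (mul_xInv_pow_mem f g s) (mul_yInv_pow_mem f h s)

theorem two_eq_zero_Lloc [CharP k 2] : (2 : Lloc k f) = 0 := by
  have h := congrArg (algebraMap k (Lloc k f)) (CharP.cast_eq_zero k 2)
  simpa only [Nat.cast_ofNat, map_ofNat, map_zero] using h

theorem sq_mem_Asub [CharP k 2] {c : Lloc k f} (hc : c ∈ Asub k f) : c ^ 2 ∈ Asub k f := by
  obtain ⟨g, h, s, rfl⟩ := (mem_Asub_iff_s6 f).mp hc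
  refine (mem_Asub_iff_s6 f).mpr ⟨g ^ 2, h ^ 2, 2 * s, ?_⟩
  rw [map_pow, map_pow]
  linear_combination (algebraMap (Rq k f) (Lloc k f) g * xInv f ^ s *
    algebraMap (Rq k f) (Lloc k f) h * yInv f ^ s) * two_eq_zero_Lloc f

/-- The element `z ^ s / (x ^ (i + 1) * y ^ (j + 1))` of `L`. -/
def cechMonomial (i : Fin 2 × ℕ × ℕ) : Lloc k f :=
  zL f ^ (i.1 : ℕ) * xInv f ^ (i.2.1 + 1) * yInv f ^ (i.2.2 + 1)

theorem algebraMap_eq_C (a : k) :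
    algebraMap k (Lloc k f) a = algebraMap (Rq k f) (Lloc k f) (Ideal.Quotient.mk _ (C a)) := by
  rw [IsScalarTower.algebraMap_apply k (Rq k f) (Lloc k f)]
  rfl

/-- The monomials `cechMonomial f i` span `L / A` over `k`. -/
theorem mem_sup_span_cechMonomial {g : PS k} (hf : f = X 2 ^ 2 + X 0 * g) (c : Lloc k f) :
    c ∈ (Asub k f).restrictScalars k ⊔ Submodule.span k (Set.range (cechMonomial f)) := by
  set W := (Asub k f).restrictScalars k ⊔ Submodule.span k (Set.range (cechMonomial f))
  have hA {d : Lloc k f} (hd : d ∈ Asub k f) : d ∈ W :=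
    Submodule.mem_sup_left (S := (Asub k f).restrictScalars k) hd
  have hM (a : k) (i) : algebraMap k (Lloc k f) a * cechMonomial f i ∈ W := by
    rw [← Algebra.smul_def]
    exact W.smul_mem a (Submodule.mem_sup_right (Submodule.subset_span ⟨i, rfl⟩))
  have hrel : zL f ^ 2 = - xL f * algebraMap (Rq k f) (Lloc k f) (Ideal.Quotient.mk _ g) := by
    have h : (Ideal.Quotient.mk (Ideal.span {f}) f : Rq k f) = 0 :=
      Ideal.Quotient.eq_zero_iff_mem.mpr (Ideal.mem_span_singleton_self f)
    rw [congrArg (Ideal.Quotient.mk (Ideal.span {f})) hf, map_add, map_mul, map_pow] at h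
    have h' := congrArg (algebraMap (Rq k f) (Lloc k f)) h
    rw [map_add, map_mul, map_pow, map_zero] at h'
    linear_combination h'
  have key (n : ℕ) : ∀ (i j : ℕ), i + j = n → ∀ φ : Rq k f,
      algebraMap _ _ φ * xInv f ^ i * yInv f ^ j ∈ W := by
    induction n with
    | zero =>
      intro i j hij φ
      obtain ⟨rfl, rfl⟩ : i = 0 ∧ j = 0 := by omega
      rw [pow_zero, mul_one]
      exact hA (mul_yInv_pow_mem f φ 0)
    | succ n ih =>
      intro i j hij φ
      rcases i with _ | i
      · rw [pow_zero, mul_one]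
        exact hA (mul_yInv_pow_mem f φ _)
      rcases j with _ | j
      · rw [pow_zero, mul_one]
        exact hA (mul_xInv_pow_mem f φ _)
      obtain ⟨φ, rfl⟩ := Ideal.Quotient.mk_surjective φ
      obtain ⟨α, β, u, v, w, rfl⟩ := exists_eq_C_add_C_mul_X_add φ
      have h0 := hM α (0, i, j)
      have h1 := hM β (1, i, j)
      have h2 := ih i (j + 1) (by omega) (Ideal.Quotient.mk _ (u - g * w))
      have h3 := ih (i + 1) j (by omega) (Ideal.Quotient.mk _ v)
      convert add_mem (add_mem h0 h1) (add_mem h2 h3) using 1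
      rw [algebraMap_eq_C, algebraMap_eq_C]
      simp only [cechMonomial, map_add, map_sub, map_mul, map_pow, Fin.val_zero, Fin.val_one,
        pow_zero, pow_one]
      set U := algebraMap (Rq k f) (Lloc k f) (Ideal.Quotient.mk _ u)
      set V := algebraMap (Rq k f) (Lloc k f) (Ideal.Quotient.mk _ v)
      set P := algebraMap (Rq k f) (Lloc k f) (Ideal.Quotient.mk _ w)
      set Q := algebraMap (Rq k f) (Lloc k f) (Ideal.Quotient.mk _ g)
      linear_combination (P * xInv f ^ (i + 1) * yInv f ^ (j + 1)) * hrel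
        + ((U - Q * P) * xInv f ^ i * yInv f ^ (j + 1)) * xL_mul_xInv f
        + (V * xInv f ^ (i + 1) * yInv f ^ j) * yL_mul_yInv f
  obtain ⟨n, φ, h⟩ := IsLocalization.Away.surj (xR k f * yR k f) c
  have hc : c = algebraMap _ _ φ * xInv f ^ n * yInv f ^ n := by
    rw [← h, map_mul, mul_pow]
    linear_combination (-c) * xL_pow_mul_xInv_pow f n
      - (c * xL f ^ n * xInv f ^ n) * yL_pow_mul_yInv_pow f n
  rw [hc]
  exact key _ n n rfl φ

/-- The numerator of a combination of the `cechMonomial f i` over the denominator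
`(x * y) ^ n`. -/
def cechNumerator (n : ℕ) (l : Fin 2 × ℕ × ℕ →₀ k) : PS k :=
  l.sum fun i a => C a * X 0 ^ (n - 1 - i.2.1) * X 1 ^ (n - 1 - i.2.2) * X 2 ^ (i.1 : ℕ)

theorem coeff_C_mul_X_pow (a : k) (p q s : ℕ) (m : Fin 3 →₀ ℕ) :
    coeff m (C a * X 0 ^ p * X 1 ^ q * X 2 ^ s : PS k) =
      if m 0 = p ∧ m 1 = q ∧ m 2 = s then a else 0 := by
  classical
  rw [X_pow_eq, X_pow_eq, X_pow_eq, mul_assoc, mul_assoc, monomial_mul_monomial,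
    monomial_mul_monomial, coeff_C_mul, coeff_monomial]
  simp [Finsupp.ext_iff, Fin.forall_fin_succ, Finsupp.single_apply]

theorem algebraMap_cechNumerator {n : ℕ} {l : Fin 2 × ℕ × ℕ →₀ k}
    (hl : ∀ i ∈ l.support, i.2.1 < n ∧ i.2.2 < n) :
    algebraMap (Rq k f) (Lloc k f) (Ideal.Quotient.mk _ (cechNumerator n l)) =
      xL f ^ n * yL f ^ n * Finsupp.linearCombination k (cechMonomial f) l := by
  rw [cechNumerator, Finsupp.linearCombination_apply, Finsupp.sum, Finsupp.sum, map_sum, map_sum,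
    Finset.mul_sum]
  refine Finset.sum_congr rfl fun i hi => ?_
  obtain ⟨h1, h2⟩ := hl i hi
  obtain ⟨s, a, b⟩ := i
  obtain ⟨p, rfl⟩ := Nat.exists_eq_add_of_lt h1
  obtain ⟨q, hq⟩ := Nat.exists_eq_add_of_lt h2
  simp only at hq
  have e1 : a + p + 1 - 1 - a = p := by omega
  have e2 : a + p + 1 - 1 - b = q := by omega
  rw [Algebra.smul_def, algebraMap_eq_C]
  simp only [e1, e2, map_mul, map_pow, cechMonomial]
  have hx := xL_pow_mul_xInv_pow f (a + 1)
  have hy := yL_pow_mul_yInv_pow f (b + 1)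
  have ex : xL f ^ (a + p + 1) = xL f ^ (a + 1) * xL f ^ p := by ring
  have ey : yL f ^ (a + p + 1) = yL f ^ (b + 1) * yL f ^ q := by rw [hq]; ring
  rw [ex, ey]
  set U := algebraMap (Rq k f) (Lloc k f) (Ideal.Quotient.mk _ (C (l (s, a, b))))
  linear_combination (-U * xL f ^ p * yL f ^ q * zL f ^ (s : ℕ)) * hx
    - (U * xL f ^ p * yL f ^ q * zL f ^ (s : ℕ) * xL f ^ (a + 1) * xInv f ^ (a + 1)) * hy

theorem coeff_cechNumerator {n : ℕ} {l : Fin 2 × ℕ × ℕ →₀ k}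
    (hl : ∀ i ∈ l.support, i.2.1 < n ∧ i.2.2 < n) {i : Fin 2 × ℕ × ℕ} (hi : i ∈ l.support)
    {m : Fin 3 →₀ ℕ} (h0 : m 0 = n - 1 - i.2.1) (h1 : m 1 = n - 1 - i.2.2)
    (h2 : m 2 = (i.1 : ℕ)) :
    coeff m (cechNumerator n l) = l i := by
  rw [cechNumerator, Finsupp.sum, map_sum, Finset.sum_eq_single_of_mem i hi]
  · rw [coeff_C_mul_X_pow, if_pos ⟨h0, h1, h2⟩]
  · intro j hj hji
    rw [coeff_C_mul_X_pow, if_neg]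
    rintro ⟨g0, g1, g2⟩
    have := hl i hi
    have := hl j hj
    exact hji (Prod.ext (Fin.ext (by omega)) (Prod.ext (by omega) (by omega)))

theorem eq_zero_of_linearCombination_mem_Asub {g : PS k} (hf : f = X 2 ^ 2 + X 0 * g)
    (l : Fin 2 × ℕ × ℕ →₀ k)
    (h : Finsupp.linearCombination k (cechMonomial f) l ∈ Asub k f) : l = 0 := by
  obtain ⟨p, q, s, h⟩ := (mem_Asub_iff_s6 f).mp h
  set n₀ := s + l.support.sup fun i => i.2.1 + i.2.2 + 1 with hn₀
  have hlt (i) (hi : i ∈ l.support) : i.2.1 + i.2.2 < n₀ := by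
    have := Finset.le_sup (f := fun i : Fin 2 × ℕ × ℕ => i.2.1 + i.2.2 + 1) hi
    omega
  obtain ⟨t, ht⟩ : ∃ t, n₀ = s + t := ⟨_, hn₀⟩
  have hl₀ : ∀ i ∈ l.support, i.2.1 < n₀ ∧ i.2.2 < n₀ := fun i hi => by
    have := hlt i hi
    omega
  have hmul := algebraMap_cechNumerator f hl₀
  have hfrac : algebraMap (Rq k f) (Lloc k f) (Ideal.Quotient.mk _ (cechNumerator n₀ l)) =
      algebraMap (Rq k f) (Lloc k f) (p * xR k f ^ t * yR k f ^ n₀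
        + q * yR k f ^ t * xR k f ^ n₀) := by
    rw [hmul, h, ht]
    simp only [map_mul, map_add, map_pow]
    linear_combination
      (algebraMap (Rq k f) (Lloc k f) p * xL f ^ t * yL f ^ (s + t)) * xL_pow_mul_xInv_pow f s
      + (algebraMap (Rq k f) (Lloc k f) q * yL f ^ t * xL f ^ (s + t)) * yL_pow_mul_yInv_pow f s
  obtain ⟨⟨_, M, rfl⟩, hM⟩ :=
    (IsLocalization.eq_iff_exists (Submonoid.powers (xR k f * yR k f)) (Lloc k f)).mp hfrac
  simp only at hM
  obtain ⟨p, rfl⟩ := Ideal.Quotient.mk_surjective p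
  obtain ⟨q, rfl⟩ := Ideal.Quotient.mk_surjective q
  have hD : (X 0 * X 1) ^ M * cechNumerator n₀ l
      - (X 0 * X 1) ^ M * (p * X 0 ^ t * X 1 ^ n₀ + q * X 1 ^ t * X 0 ^ n₀)
      ∈ Ideal.span {f} := by
    rw [← Ideal.Quotient.eq]
    simpa only [map_mul, map_add, map_pow] using hM
  obtain ⟨w, hw⟩ := Ideal.mem_span_singleton'.mp hD
  have hshift : (X 0 * X 1) ^ M * cechNumerator n₀ l = cechNumerator (n₀ + M) l := by
    rw [cechNumerator, cechNumerator, Finsupp.sum, Finsupp.sum, Finset.mul_sum]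
    refine Finset.sum_congr rfl fun i hi => ?_
    have := hl₀ i hi
    rw [show n₀ + M - 1 - i.2.1 = M + (n₀ - 1 - i.2.1) by omega,
      show n₀ + M - 1 - i.2.2 = M + (n₀ - 1 - i.2.2) by omega]
    ring
  rw [hshift] at hw
  have hG : cechNumerator (n₀ + M) l = X 0 ^ (n₀ + M) * (q * X 1 ^ (t + M))
      + X 1 ^ (n₀ + M) * (p * X 0 ^ (t + M)) + (X 2 ^ 2 + X 0 * g) * w := by
    rw [← hf]
    linear_combination -hw
  have hz : ∀ m : Fin 3 →₀ ℕ, 2 ≤ m 2 → coeff m (cechNumerator (n₀ + M) l) = 0 := by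
    intro m hm
    rw [cechNumerator, Finsupp.sum, map_sum]
    refine Finset.sum_eq_zero fun i _ => ?_
    rw [coeff_C_mul_X_pow, if_neg]
    rintro ⟨-, -, h2⟩
    have := i.1.isLt
    omega
  have hcoeff := coeff_eq_zero_of_eq g hG hz
  by_contra hne
  obtain ⟨i, hi⟩ := Finsupp.support_nonempty_iff.mpr hne
  have hi' := hlt i hi
  let m : Fin 3 →₀ ℕ := Finsupp.single 0 (n₀ + M - 1 - i.2.1)
    + Finsupp.single 1 (n₀ + M - 1 - i.2.2) + Finsupp.single 2 (i.1 : ℕ)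
  have m0 : m 0 = n₀ + M - 1 - i.2.1 := by simp [m]
  have m1 : m 1 = n₀ + M - 1 - i.2.2 := by simp [m]
  have m2 : m 2 = (i.1 : ℕ) := by simp [m]
  refine Finsupp.mem_support_iff.mp hi ?_
  rw [← coeff_cechNumerator (n := n₀ + M) (fun j hj => ?_) hi m0 m1 m2]
  · exact hcoeff m (by omega) (by omega)
  · have := hlt j hj
    omega

/-- Coordinates on `L / A` with respect to the classes of the `cechMonomial f i`. -/
theorem exists_cech_coordinates {g : PS k} (hf : f = X 2 ^ 2 + X 0 * g) :
    ∃ κ : Lloc k f →ₗ[k] (Fin 2 × ℕ × ℕ →₀ k),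
      (∀ c, κ c = 0 ↔ c ∈ Asub k f) ∧
      ∀ i, κ (cechMonomial f i) = Finsupp.single i 1 := by
  let A := (Asub k f).restrictScalars k
  let v := A.mkQ ∘ cechMonomial f
  have hli : LinearIndependent k v := by
    rw [linearIndependent_iff]
    intro l hl
    refine eq_zero_of_linearCombination_mem_Asub f hf l ?_
    rw [← Finsupp.apply_linearCombination, Submodule.mkQ_apply,
      Submodule.Quotient.mk_eq_zero] at hl
    exact hl
  have hsp : ⊤ ≤ Submodule.span k (Set.range v) := by
    rintro c -
    obtain ⟨c, rfl⟩ := A.mkQ_surjective c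
    obtain ⟨a, ha, b, hb, rfl⟩ := Submodule.mem_sup.mp (mem_sup_span_cechMonomial f hf c)
    rw [map_add, Submodule.mkQ_apply A a, (Submodule.Quotient.mk_eq_zero A).mpr ha, zero_add,
      Set.range_comp, ← Submodule.map_span]
    exact Submodule.mem_map_of_mem hb
  let B := Module.Basis.mk hli hsp
  refine ⟨B.repr.toLinearMap ∘ₗ A.mkQ, fun c => ?_, fun i => ?_⟩
  · rw [LinearMap.comp_apply, LinearEquiv.coe_coe, LinearEquiv.map_eq_zero_iff,
      Submodule.mkQ_apply, Submodule.Quotient.mk_eq_zero]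
    rfl
  · rw [LinearMap.comp_apply, LinearEquiv.coe_coe, ← B.repr_self, Module.Basis.mk_apply]
    rfl

end Cech

section Frobenius

variable {k : Type} [Field k] {f : PS k} {κ : Lloc k f →ₗ[k] (Fin 2 × ℕ × ℕ →₀ k)}

theorem coord_monomial (hκA : ∀ c, κ c = 0 ↔ c ∈ Asub k f)
    (hκ : ∀ i, κ (cechMonomial f i) = Finsupp.single i 1) (s : Fin 2) (a b i j : ℕ) :
    κ (zL f ^ (s : ℕ) * xL f ^ a * yL f ^ b * xInv f ^ i * yInv f ^ j) =
      if a < i ∧ b < j then Finsupp.single (s, i - a - 1, j - b - 1) 1 else 0 := by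
  split_ifs with h
  · obtain ⟨p, rfl⟩ := Nat.exists_eq_add_of_lt h.1
    obtain ⟨q, rfl⟩ := Nat.exists_eq_add_of_lt h.2
    rw [show a + p + 1 - a - 1 = p by omega, show b + q + 1 - b - 1 = q by omega, ← hκ]
    congr 1
    rw [cechMonomial]
    linear_combination
      (zL f ^ (s : ℕ) * yL f ^ b * yInv f ^ (b + q + 1) * xInv f ^ (p + 1)) *
        xL_pow_mul_xInv_pow f a
      + (zL f ^ (s : ℕ) * xInv f ^ (p + 1) * yInv f ^ (q + 1)) * yL_pow_mul_yInv_pow f b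
  · rw [hκA]
    rcases le_or_gt i a with hi | hi
    · obtain ⟨p, rfl⟩ := Nat.exists_eq_add_of_le hi
      convert mul_yInv_pow_mem f (zR k f ^ (s : ℕ) * xR k f ^ p * yR k f ^ b) j using 1
      simp only [map_mul, map_pow]
      linear_combination (zL f ^ (s : ℕ) * xL f ^ p * yL f ^ b * yInv f ^ j) *
        xL_pow_mul_xInv_pow f i
    · have hj : j ≤ b := by omega
      obtain ⟨p, rfl⟩ := Nat.exists_eq_add_of_le hj
      convert mul_xInv_pow_mem f (zR k f ^ (s : ℕ) * xR k f ^ a * yR k f ^ p) i using 1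
      simp only [map_mul, map_pow]
      linear_combination (zL f ^ (s : ℕ) * xL f ^ a * yL f ^ p * xInv f ^ i) *
        yL_pow_mul_yInv_pow f j

theorem coord_sq_of_coord_monomial_sq [CharP k 2] {g : PS k} (hf : f = X 2 ^ 2 + X 0 * g)
    (hκA : ∀ c, κ c = 0 ↔ c ∈ Asub k f)
    (hκ : ∀ i, κ (cechMonomial f i) = Finsupp.single i 1) {I I' : Fin 2 × ℕ × ℕ}
    (h : ∀ i, κ (cechMonomial f i ^ 2) I = if i = I' then 1 else 0) (c : Lloc k f) :
    κ (c ^ 2) I = κ c I' ^ 2 := by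
  have hadd (c d : Lloc k f) (hc : κ (c ^ 2) I = κ c I' ^ 2) (hd : κ (d ^ 2) I = κ d I' ^ 2) :
      κ ((c + d) ^ 2) I = κ (c + d) I' ^ 2 := by
    have e : (c + d) ^ 2 = c ^ 2 + d ^ 2 := by
      linear_combination (c * d) * two_eq_zero_Lloc f
    rw [e, map_add, map_add, Finsupp.add_apply, Finsupp.add_apply, hc, hd, CharTwo.add_sq]
  obtain ⟨a, ha, b, hb, rfl⟩ := Submodule.mem_sup.mp (mem_sup_span_cechMonomial f hf c)
  refine hadd a b ?_ ?_
  · rw [(hκA _).mpr (sq_mem_Asub f ha), (hκA a).mpr ha]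
    simp
  · induction hb using Submodule.span_induction with
    | mem b hb =>
      obtain ⟨i, rfl⟩ := hb
      rw [h, hκ, Finsupp.single_apply]
      split_ifs <;> simp
    | zero => simp
    | add b d _ _ hb hd => exact hadd b d hb hd
    | smul r b _ hb =>
      rw [smul_pow, map_smul, map_smul, Finsupp.smul_apply, Finsupp.smul_apply, hb,
        smul_eq_mul, smul_eq_mul, mul_pow]

variable {m N : ℕ}

theorem zL_sq [CharP k 2] (hf : f = X 2 ^ 2 + X 0 * (X 0 * X 1 + X 1 ^ m + X 2 * X 1 ^ N)) :
    zL f ^ 2 = xL f * yL f ^ N * zL f + xL f ^ 2 * yL f + xL f * yL f ^ m := by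
  have h : (Ideal.Quotient.mk (Ideal.span {f}) f : Rq k f) = 0 :=
    Ideal.Quotient.eq_zero_iff_mem.mpr (Ideal.mem_span_singleton_self f)
  rw [congrArg (Ideal.Quotient.mk (Ideal.span {f})) hf] at h
  have h' := congrArg (algebraMap (Rq k f) (Lloc k f)) h
  simp only [map_add, map_mul, map_pow, map_zero] at h'
  linear_combination h' - (xL f * yL f ^ N * zL f + xL f ^ 2 * yL f + xL f * yL f ^ m) *
    two_eq_zero_Lloc f

theorem coord_cechMonomial_zero_sq (hκ : ∀ i, κ (cechMonomial f i) = Finsupp.single i 1)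
    (i j : ℕ) :
    κ (cechMonomial f (0, i, j) ^ 2) = Finsupp.single (0, 2 * i + 1, 2 * j + 1) 1 := by
  rw [← hκ]
  congr 1
  simp only [cechMonomial, Fin.val_zero, pow_zero]
  ring

theorem coord_cechMonomial_one_sq [CharP k 2]
    (hf : f = X 2 ^ 2 + X 0 * (X 0 * X 1 + X 1 ^ m + X 2 * X 1 ^ N))
    (hκA : ∀ c, κ c = 0 ↔ c ∈ Asub k f)
    (hκ : ∀ i, κ (cechMonomial f i) = Finsupp.single i 1) (i j : ℕ) :
    κ (cechMonomial f (1, i, j) ^ 2) =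
      (if N < 2 * j + 2 then Finsupp.single (1, 2 * i, 2 * j + 1 - N) 1 else 0)
      + (if 0 < i then Finsupp.single (0, 2 * i - 1, 2 * j) 1 else 0)
      + (if m < 2 * j + 2 then Finsupp.single (0, 2 * i, 2 * j + 1 - m) 1 else 0) := by
  have h := coord_monomial hκA hκ
  have h1 := h 1 1 N (2 * i + 2) (2 * j + 2)
  have h2 := h 0 2 1 (2 * i + 2) (2 * j + 2)
  have h3 := h 0 1 m (2 * i + 2) (2 * j + 2)
  have e1 : 2 * i + 2 - 1 - 1 = 2 * i := by omega
  have e2 : 2 * i + 2 - 2 - 1 = 2 * i - 1 := by omega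
  have e3 : 2 * j + 2 - 1 - 1 = 2 * j := by omega
  have e4 : 2 * j + 2 - N - 1 = 2 * j + 1 - N := by omega
  have e5 : 2 * j + 2 - m - 1 = 2 * j + 1 - m := by omega
  have c1 : (1 < 2 * i + 2 ∧ N < 2 * j + 2) ↔ N < 2 * j + 2 := by omega
  have c2 : (2 < 2 * i + 2 ∧ 1 < 2 * j + 2) ↔ 0 < i := by omega
  have c3 : (1 < 2 * i + 2 ∧ m < 2 * j + 2) ↔ m < 2 * j + 2 := by omega
  simp only [e1, e2, e3, e4, e5, c1, c2, c3] at h1 h2 h3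
  rw [← h1, ← h2, ← h3, ← map_add, ← map_add]
  congr 1
  simp only [cechMonomial, Fin.val_zero, Fin.val_one, pow_zero]
  linear_combination (xInv f ^ (2 * i + 2) * yInv f ^ (2 * j + 2)) * zL_sq hf

theorem coord_sq_zero_odd_odd [CharP k 2]
    (hf : f = X 2 ^ 2 + X 0 * (X 0 * X 1 + X 1 ^ m + X 2 * X 1 ^ N))
    (hκA : ∀ c, κ c = 0 ↔ c ∈ Asub k f)
    (hκ : ∀ i, κ (cechMonomial f i) = Finsupp.single i 1)
    (i j : ℕ) (c : Lloc k f) :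
    κ (c ^ 2) (0, 2 * i + 1, 2 * j + 1) = κ c (0, i, j) ^ 2 := by
  refine coord_sq_of_coord_monomial_sq hf hκA hκ ?_ c
  rintro ⟨s, a, b⟩
  obtain rfl | rfl : s = 0 ∨ s = 1 := by fin_cases s <;> simp
  · rw [coord_cechMonomial_zero_sq hκ, Finsupp.single_apply]
    clear hf hκA hκ c
    grind
  · rw [coord_cechMonomial_one_sq hf hκA hκ]
    clear hf hκA hκ c
    split_ifs <;>
      simp only [Finsupp.add_apply, Finsupp.single_apply, Finsupp.zero_apply] <;>
      grind

theorem coord_sq_zero_odd_even [CharP k 2]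
    (hf : f = X 2 ^ 2 + X 0 * (X 0 * X 1 + X 1 ^ m + X 2 * X 1 ^ N))
    (hκA : ∀ c, κ c = 0 ↔ c ∈ Asub k f)
    (hκ : ∀ i, κ (cechMonomial f i) = Finsupp.single i 1)
    (i j : ℕ) (c : Lloc k f) :
    κ (c ^ 2) (0, 2 * i + 1, 2 * j) = κ c (1, i + 1, j) ^ 2 := by
  refine coord_sq_of_coord_monomial_sq hf hκA hκ ?_ c
  rintro ⟨s, a, b⟩
  obtain rfl | rfl : s = 0 ∨ s = 1 := by fin_cases s <;> simp
  · rw [coord_cechMonomial_zero_sq hκ, Finsupp.single_apply]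
    clear hf hκA hκ c
    grind
  · rw [coord_cechMonomial_one_sq hf hκA hκ]
    clear hf hκA hκ c
    split_ifs <;>
      simp only [Finsupp.add_apply, Finsupp.single_apply, Finsupp.zero_apply] <;>
      grind

theorem coord_sq_zero_even [CharP k 2]
    (hf : f = X 2 ^ 2 + X 0 * (X 0 * X 1 + X 1 ^ m + X 2 * X 1 ^ N))
    (hκA : ∀ c, κ c = 0 ↔ c ∈ Asub k f)
    (hκ : ∀ i, κ (cechMonomial f i) = Finsupp.single i 1)
    (i j : ℕ) {t : ℕ} (ht : t + m = 2 * j + 1) (c : Lloc k f) :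
    κ (c ^ 2) (0, 2 * i, t) = κ c (1, i, j) ^ 2 := by
  refine coord_sq_of_coord_monomial_sq hf hκA hκ ?_ c
  rintro ⟨s, a, b⟩
  obtain rfl | rfl : s = 0 ∨ s = 1 := by fin_cases s <;> simp
  · rw [coord_cechMonomial_zero_sq hκ, Finsupp.single_apply]
    clear hf hκA hκ c
    grind
  · rw [coord_cechMonomial_one_sq hf hκA hκ]
    clear hf hκA hκ c
    split_ifs <;>
      simp only [Finsupp.add_apply, Finsupp.single_apply, Finsupp.zero_apply] <;>
      grind

theorem coord_sq_one_even [CharP k 2]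
    (hf : f = X 2 ^ 2 + X 0 * (X 0 * X 1 + X 1 ^ m + X 2 * X 1 ^ N))
    (hκA : ∀ c, κ c = 0 ↔ c ∈ Asub k f)
    (hκ : ∀ i, κ (cechMonomial f i) = Finsupp.single i 1)
    (i j : ℕ) {t : ℕ} (ht : t + N = 2 * j + 1) (c : Lloc k f) :
    κ (c ^ 2) (1, 2 * i, t) = κ c (1, i, j) ^ 2 := by
  refine coord_sq_of_coord_monomial_sq hf hκA hκ ?_ c
  rintro ⟨s, a, b⟩
  obtain rfl | rfl : s = 0 ∨ s = 1 := by fin_cases s <;> simp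
  · rw [coord_cechMonomial_zero_sq hκ, Finsupp.single_apply]
    clear hf hκA hκ c
    grind
  · rw [coord_cechMonomial_one_sq hf hκA hκ]
    clear hf hκA hκ c
    split_ifs <;>
      simp only [Finsupp.add_apply, Finsupp.single_apply, Finsupp.zero_apply] <;>
      grind

theorem coord_eq_zero_of_pow_mem_Asub [CharP k 2]
    (hf : f = X 2 ^ 2 + X 0 * (X 0 * X 1 + X 1 ^ m + X 2 * X 1 ^ N))
    (hκA : ∀ c, κ c = 0 ↔ c ∈ Asub k f)
    (hκ : ∀ i, κ (cechMonomial f i) = Finsupp.single i 1) {J : ℕ}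
    (hJ : ∀ j, j ≤ J ↔ 2 * j ≤ m ∧ j < N) (n : ℕ) (c : Lloc k f)
    (hc : c ^ 2 ^ n ∈ Asub k f) (i : Fin 2 × ℕ × ℕ)
    (hi : ¬(i.1 = 1 ∧ i.2.1 = 0 ∧ i.2.2 + 1 ≤ J)) : κ c i = 0 := by
  induction n generalizing c i with
  | zero =>
    rw [pow_zero, pow_one] at hc
    rw [(hκA c).mpr hc, Finsupp.zero_apply]
  | succ n ih =>
    rw [pow_succ', pow_mul] at hc
    have ih' := ih _ hc
    obtain ⟨s, a, b⟩ := i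
    obtain rfl | rfl : s = 0 ∨ s = 1 := by fin_cases s <;> simp
    · rw [← sq_eq_zero_iff, ← coord_sq_zero_odd_odd hf hκA hκ]
      exact ih' _ (by simp)
    · rcases a with _ | a
      · have hb : ¬(b + 1 ≤ J) := fun h => hi ⟨rfl, rfl, h⟩
        by_cases hm : m < 2 * (b + 1)
        · rw [← sq_eq_zero_iff, ← coord_sq_zero_even hf hκA hκ 0 b
            (show 2 * b + 1 - m + m = 2 * b + 1 by omega)]
          exact ih' _ (by simp)
        · have hN : N ≤ b + 1 := by
            by_contra h
            exact hb ((hJ _).mpr ⟨by omega, by omega⟩)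
          rw [← sq_eq_zero_iff, ← coord_sq_one_even hf hκA hκ 0 b
            (show 2 * b + 1 - N + N = 2 * b + 1 by omega)]
          refine ih' _ ?_
          rintro ⟨-, -, h⟩
          have := ((hJ _).mp h).2
          simp only at this
          omega
      · rw [← sq_eq_zero_iff, ← coord_sq_zero_odd_even hf hκA hκ]
        exact ih' _ (by simp)

theorem cechMonomial_one_zero {j : ℕ} (hj : 1 ≤ j) :
    cechMonomial f (1, 0, j - 1) = fcls k f j := by
  rw [fcls_eq f hj, cechMonomial, Nat.sub_add_cancel hj]
  simp

theorem coord_sum_fcls (hκ : ∀ i, κ (cechMonomial f i) = Finsupp.single i 1) (J : ℕ)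
    (a : ℕ → k) (i : Fin 2 × ℕ × ℕ) :
    κ (∑ j ∈ Finset.Icc 1 J, algebraMap k (Rq k f) (a j) • fcls k f j) i =
      if i.1 = 1 ∧ i.2.1 = 0 ∧ i.2.2 + 1 ≤ J then a (i.2.2 + 1) else 0 := by
  have hterm : ∀ j ∈ Finset.Icc 1 J, κ (algebraMap k (Rq k f) (a j) • fcls k f j) i =
      if i = (1, 0, j - 1) then a j else 0 := fun j hj => by
    have hsmul : algebraMap k (Rq k f) (a j) • fcls k f j = a j • fcls k f j :=
      algebraMap_smul (Rq k f) (a j) (fcls k f j)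
    rw [hsmul, map_smul, ← cechMonomial_one_zero (Finset.mem_Icc.mp hj).1, hκ,
      Finsupp.smul_apply, Finsupp.single_apply, smul_eq_mul, mul_ite, mul_one, mul_zero]
    exact if_congr eq_comm rfl rfl
  rw [map_sum, Finsupp.finsetSum_apply, Finset.sum_congr rfl hterm]
  obtain ⟨s, p, q⟩ := i
  split_ifs with h
  · obtain ⟨rfl, rfl, h⟩ := h
    rw [Finset.sum_eq_single_of_mem (q + 1) (Finset.mem_Icc.mpr ⟨by omega, h⟩)]
    · simp
    · intro j hj hne
      have := (Finset.mem_Icc.mp hj).1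
      refine if_neg fun e => hne ?_
      simp only [Prod.mk.injEq, true_and] at e
      omega
  · refine Finset.sum_eq_zero fun j hj => if_neg ?_
    have := Finset.mem_Icc.mp hj
    rintro ⟨⟩
    exact h ⟨rfl, rfl, by simp only; omega⟩

theorem add_pow_two_pow_mem_Asub [CharP k 2] {a b : Lloc k f} {n : ℕ}
    (ha : a ^ 2 ^ n ∈ Asub k f) (hb : b ∈ Asub k f) : (a + b) ^ 2 ^ n ∈ Asub k f := by
  induction n generalizing a b with
  | zero =>
    rw [pow_zero, pow_one] at ha ⊢
    exact add_mem ha hb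
  | succ n ih =>
    rw [pow_succ', pow_mul] at ha ⊢
    have e : (a + b) ^ 2 = a ^ 2 + b ^ 2 := by
      linear_combination (a * b) * two_eq_zero_Lloc f
    rw [e]
    exact ih ha (sq_mem_Asub f hb)

theorem exists_fcls_pow_mem_Asub [CharP k 2]
    (hf : f = X 2 ^ 2 + X 0 * (X 0 * X 1 + X 1 ^ m + X 2 * X 1 ^ N))
    (j : ℕ) (hj : 1 ≤ j) (hjm : 2 * j ≤ m) (hjN : j < N) :
    ∃ n : ℕ, fcls k f j ^ 2 ^ n ∈ Asub k f := by
  induction j using Nat.strong_induction_on with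
  | _ j ih =>
    have hsq : fcls k f j ^ 2 = zL f * xInv f * yL f ^ N * yInv f ^ (2 * j)
        + (yL f * yInv f ^ (2 * j) + yL f ^ m * xInv f * yInv f ^ (2 * j)) := by
      rw [fcls_eq f hj]
      linear_combination (xInv f ^ 2 * yInv f ^ (2 * j)) * zL_sq hf
        + (yInv f ^ (2 * j) * (xInv f * yL f ^ N * zL f + xInv f * yL f ^ m
          + (xL f * xInv f + 1) * yL f)) * xL_mul_xInv f
    have hrest : yL f * yInv f ^ (2 * j) + yL f ^ m * xInv f * yInv f ^ (2 * j) ∈ Asub k f := by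
      refine add_mem (mul_yInv_pow_mem f _ _) ?_
      obtain ⟨t, rfl⟩ := Nat.exists_eq_add_of_le hjm
      convert mul_xInv_pow_mem f (yR k f ^ t) 1 using 1
      rw [map_pow]
      linear_combination (yL f ^ t * xInv f) * yL_pow_mul_yInv_pow f (2 * j)
    by_cases h : 2 * j ≤ N
    · refine ⟨1, ?_⟩
      rw [pow_one, hsq]
      refine add_mem ?_ hrest
      obtain ⟨t, rfl⟩ := Nat.exists_eq_add_of_le h
      convert mul_xInv_pow_mem f (zR k f * yR k f ^ t) 1 using 1
      rw [map_mul, map_pow]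
      linear_combination (zL f * yL f ^ t * xInv f) * yL_pow_mul_yInv_pow f (2 * j)
    · obtain ⟨t, ht⟩ := Nat.exists_eq_add_of_lt (not_le.mp h)
      obtain ⟨n, hn⟩ := ih (t + 1) (by omega) (by omega) (by omega) (by omega)
      refine ⟨n + 1, ?_⟩
      have hf' : zL f * xInv f * yL f ^ N * yInv f ^ (2 * j) = fcls k f (t + 1) := by
        rw [fcls_eq f (by omega), ht]
        linear_combination (zL f * xInv f * yInv f ^ (t + 1)) * yL_pow_mul_yInv_pow f N
      rw [pow_succ', pow_mul, hsq, hf']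
      exact add_pow_two_pow_mem_Asub hn hrest

end Frobenius

/-- Local cohomology of the rational double point of type D2m_r
in characteristic 2: the Frobenius-nilpotent part `H^2_m(R)[F^∞]` of `L/A` has
k-basis the classes of `z/(x y^j)` for `j ≥ 1` with `2j-1 ≤ L' = min(m-1, 2m-2r-2)`;
in particular it has dimension `⌊(L'+1)/2⌋`. -/
theorem localCohomology_D2m_r (k : Type) [Field k] [IsAlgClosed k] [CharP k 2]
    (m r : ℕ) (hm : 2 ≤ m) (hr : r ≤ m - 1) :
    -- the defining equation of D2m_r and the bound L'
    ∀ f : PS k, f = X 2 ^ 2 + X 0 ^ 2 * X 1 + X 0 * X 1 ^ m + X 2 * X 0 * X 1 ^ (m - r) →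
    ∀ L' : ℕ, L' = min (m - 1) (2 * m - 2 * r - 2) →
    -- (i) each z/(x y^j) with 1 ≤ j and 2j - 1 ≤ L' is Frobenius-nilpotent modulo A
    (∀ j : ℕ, 1 ≤ j → 2 * j - 1 ≤ L' →
      ∃ m' : ℕ, (fcls k f j) ^ 2 ^ m' ∈ Asub k f) ∧
    -- (ii) the classes of these elements in L/A are k-linearly independent
    (∀ a : ℕ → k,
      (∑ j ∈ Finset.Icc 1 ((L' + 1) / 2), algebraMap k (Rq k f) (a j) • fcls k f j)
        ∈ Asub k f →
      ∀ j ∈ Finset.Icc 1 ((L' + 1) / 2), a j = 0) ∧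
    -- (iii) every Frobenius-nilpotent class is a k-linear combination of these classes
    (∀ c : Lloc k f, (∃ m' : ℕ, c ^ 2 ^ m' ∈ Asub k f) →
      ∃ a : ℕ → k,
        c - ∑ j ∈ Finset.Icc 1 ((L' + 1) / 2), algebraMap k (Rq k f) (a j) • fcls k f j
          ∈ Asub k f) := by
  intro f hf₀ L' hL'
  have hf : f = X 2 ^ 2 + X 0 * (X 0 * X 1 + X 1 ^ m + X 2 * X 1 ^ (m - r)) := by
    rw [hf₀]
    ring
  have hJ (j : ℕ) : j ≤ (L' + 1) / 2 ↔ 2 * j ≤ m ∧ j < m - r := by omega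
  obtain ⟨κ, hκA, hκ⟩ := exists_cech_coordinates f hf
  refine ⟨fun j hj hjL => ?_, fun a ha j hj => ?_, fun c ⟨n, hc⟩ => ?_⟩
  · obtain ⟨hjm, hjN⟩ := (hJ j).mp (by omega)
    exact exists_fcls_pow_mem_Asub hf j hj hjm hjN
  · have h := coord_sum_fcls hκ ((L' + 1) / 2) a (1, 0, j - 1)
    have hj' := Finset.mem_Icc.mp hj
    rw [(hκA _).mpr ha, Finsupp.zero_apply, Nat.sub_add_cancel hj'.1,
      if_pos ⟨rfl, rfl, hj'.2⟩] at h
    exact h.symm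
  · refine ⟨fun j => κ c (1, 0, j - 1), (hκA _).mp ?_⟩
    ext i
    rw [map_sub, Finsupp.sub_apply, coord_sum_fcls hκ, Finsupp.zero_apply]
    split_ifs with hi
    · obtain ⟨s, p, q⟩ := i
      obtain ⟨rfl, rfl, -⟩ := hi
      rw [Nat.add_sub_cancel, sub_self]
    · rw [sub_zero]
      exact coord_eq_zero_of_pow_mem_Asub hf hκA hκ hJ n c hc i hi
end
end
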